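/- Let s ≥ 0, r ∈ ℝ and O = {u ∈ S : J_s(u) < r}, equipped with the topology induced by ‖·‖_{α,p}. Then every connected component of O contains a critical point of J_s restricted to S, i.e. a point u₀ in that component for which there exists μ ∈ ℝ with Λ_{n,p}(1−α)H_{α,p}(u₀,v) + ∫_Ω|u₀|^{p−2}u₀ v dx − (s/ε)∫_{Ω_ε}(u₀⁺)^{p−1}v dx = (μ/ε)∫_{Ω_ε}|u₀|^{p−2}u₀ v dx for all v ∈ W^{α,p}. -/

import Mathlib

open MeasureTheory Real Set Filter Topology

noncomputable section

/-- Points of `ℝ^n`. -/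
abbrev Pt (n : ℕ) := EuclideanSpace ℝ (Fin n)

/-- The normalizing constant `Λ_{n,p} = p Γ((n+p)/2) / (2 π^{(n-1)/2} Γ((p+1)/2))`. -/
def Lam (n : ℕ) (p : ℝ) : ℝ :=
  p * Real.Gamma (((n : ℝ) + p) / 2) /
    (2 * Real.pi ^ (((n : ℝ) - 1) / 2) * Real.Gamma ((p + 1) / 2))

variable {n : ℕ}

/-- `Q = ℝ^{2n} \ (Ω^c × Ω^c)`. -/
def Qset (Ω : Set (Pt n)) : Set (Pt n × Pt n) := (Ωᶜ ×ˢ Ωᶜ)ᶜ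

/-- The singular kernel `|x - y|^{-(n + pα)}`. -/
def kern (p α : ℝ) (z : Pt n × Pt n) : ℝ := ‖z.1 - z.2‖ ^ (-((n : ℝ) + p * α))

/-- The `p`-th power of the Gagliardo-type seminorm, `[u]_{α,p}^p`. -/
def gagP (p α : ℝ) (Ω : Set (Pt n)) (u : Pt n → ℝ) : ℝ :=
  ∫ z in Qset Ω, |u z.1 - u z.2| ^ p * kern p α z

/-- The nonlinear form `H_{α,p}(u,v)`. -/
def Hform (p α : ℝ) (Ω : Set (Pt n)) (u v : Pt n → ℝ) : ℝ :=
  ∫ z in Qset Ω,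
    |u z.1 - u z.2| ^ (p - 2) * (u z.1 - u z.2) * (v z.1 - v z.2) * kern p α z

/-- `∫_Ω |u|^p`. -/
def lpP (p : ℝ) (Ω : Set (Pt n)) (u : Pt n → ℝ) : ℝ := ∫ x in Ω, |u x| ^ p

/-- Membership in the space `W^{α,p}`: measurable with finite norm `‖u‖_{α,p}`. -/
def memW (p α : ℝ) (Ω : Set (Pt n)) (u : Pt n → ℝ) : Prop :=
  Measurable u ∧
    ((∫⁻ x in Ω, ENNReal.ofReal (|u x| ^ p)) +
      ∫⁻ z in Qset Ω, ENNReal.ofReal (|u z.1 - u z.2| ^ p * kern p α z)) < ⊤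

/-- The norm `‖u‖_{α,p} = (‖u‖_{L^p(Ω)}^p + [u]_{α,p}^p)^{1/p}`. -/
def normW (p α : ℝ) (Ω : Set (Pt n)) (u : Pt n → ℝ) : ℝ :=
  (lpP p Ω u + gagP p α Ω u) ^ (1 / p)

/-- `Ω_ε = {x ∈ Ω : dist(x, ∂Ω) ≤ ε}`. -/
def Oeps (Ω : Set (Pt n)) (ε : ℝ) : Set (Pt n) :=
  {x ∈ Ω | Metric.infDist x (frontier Ω) ≤ ε}

/-- The energy `Λ_{n,p}(1-α)[u]_{α,p}^p + ∫_Ω |u|^p`. -/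
def energy (p α : ℝ) (Ω : Set (Pt n)) (u : Pt n → ℝ) : ℝ :=
  Lam n p * (1 - α) * gagP p α Ω u + lpP p Ω u

/-- The constraint sphere `S = {u ∈ W^{α,p} : (1/ε)∫_{Ω_ε}|u|^p = 1}`. -/
def sphereS (p α ε : ℝ) (Ω : Set (Pt n)) (u : Pt n → ℝ) : Prop :=
  memW p α Ω u ∧ (1 / ε) * ∫ x in Oeps Ω ε, |u x| ^ p = 1

/-- The first eigenvalue `λ_{1,ε}`. -/
def lam1 (p α ε : ℝ) (Ω : Set (Pt n)) : ℝ :=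
  sInf {r | ∃ u, sphereS p α ε Ω u ∧ r = energy p α Ω u}

/-- Positive part `u⁺`. -/
def pPart (u : Pt n → ℝ) (x : Pt n) : ℝ := max (u x) 0

/-- Negative part `u⁻`. -/
def nPart (u : Pt n → ℝ) (x : Pt n) : ℝ := max (-u x) 0

/-- The functional `J_s`. -/
def Jfun (p α ε s : ℝ) (Ω : Set (Pt n)) (u : Pt n → ℝ) : ℝ :=
  energy p α Ω u - (s / ε) * ∫ x in Oeps Ω ε, pPart u x ^ p

/-- Weak solution of the Fučik problem `(F_p)` with parameters `(a,b)`. -/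
def isWeakSol (p α ε a b : ℝ) (Ω : Set (Pt n)) (u : Pt n → ℝ) : Prop :=
  memW p α Ω u ∧ ∀ v, memW p α Ω v →
    Lam n p * (1 - α) * Hform p α Ω u v + (∫ x in Ω, |u x| ^ (p - 2) * u x * v x)
      = (a / ε) * (∫ x in Oeps Ω ε, pPart u x ^ (p - 1) * v x)
        - (b / ε) * ∫ x in Oeps Ω ε, nPart u x ^ (p - 1) * v x

/-- The Fučik spectrum `Σ_p`. -/
def SigmaP (p α ε : ℝ) (Ω : Set (Pt n)) : Set (ℝ × ℝ) :=
  {ab | ∃ u : Pt n → ℝ, isWeakSol p α ε ab.1 ab.2 Ω u ∧ ¬ (∀ᵐ x : Pt n, u x = 0)}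

/-- Continuity of a path `γ : [-1,1] → W^{α,p}` with respect to `‖·‖_{α,p}`. -/
def contPathW (p α : ℝ) (Ω : Set (Pt n)) (γ : ℝ → Pt n → ℝ) : Prop :=
  ∀ t ∈ Icc (-1 : ℝ) 1, ∀ δ > (0 : ℝ), ∃ η > (0 : ℝ), ∀ t' ∈ Icc (-1 : ℝ) 1,
    |t' - t| < η → normW p α Ω (γ t' - γ t) < δ

/-- The family of paths `Γ` on `S` joining `-φ₁` to `φ₁`. -/
def GammaSet (p α ε : ℝ) (Ω : Set (Pt n)) (φ : Pt n → ℝ) : Set (ℝ → Pt n → ℝ) :=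
  {γ | (∀ t ∈ Icc (-1 : ℝ) 1, sphereS p α ε Ω (γ t)) ∧ contPathW p α Ω γ ∧
    γ (-1) = -φ ∧ γ 1 = φ}

/-- The minimax value `c(s)`. -/
def cval (p α ε : ℝ) (Ω : Set (Pt n)) (φ : Pt n → ℝ) (s : ℝ) : ℝ :=
  sInf {r | ∃ γ ∈ GammaSet p α ε Ω φ,
    r = sSup ((fun t => Jfun p α ε s Ω (γ t)) '' Icc (-1 : ℝ) 1)}

/-- Topology on functions generated by the balls of the seminorm `‖·‖_{α,p}`. -/
def topW (p α : ℝ) (Ω : Set (Pt n)) : TopologicalSpace (Pt n → ℝ) :=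
  TopologicalSpace.generateFrom
    {B | ∃ (u : Pt n → ℝ) (r : ℝ), B = {v | normW p α Ω (v - u) < r}}

/-- First eigenvalue with constraint on a subregion `D`. -/
def lam1On (p α ε : ℝ) (Ω D : Set (Pt n)) : ℝ :=
  sInf {r | ∃ u, memW p α Ω u ∧ (1 / ε) * (∫ x in D, |u x| ^ p) = 1 ∧
    r = energy p α Ω u}

/-- Primitive `F(x,s) = ∫_0^s f(x,t) dt`. -/
def Ffun (f : Pt n → ℝ → ℝ) (x : Pt n) (s : ℝ) : ℝ := ∫ t in (0:ℝ)..s, f x t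

/-- The energy functional `Ψ` of the nonresonance problem (`p = 2`). -/
def Psi (α ε : ℝ) (Ω : Set (Pt n)) (f : Pt n → ℝ → ℝ) (u : Pt n → ℝ) : ℝ :=
  Lam n 2 * (1 - α) / 2 * gagP 2 α Ω u + (1 / 2) * lpP 2 Ω u
    - (1 / ε) * ∫ x in Oeps Ω ε, Ffun f x (u x)

theorem abs_min {V Y : Type*} [AddCommGroup V] [Module ℝ V] [NormedAddCommGroup Y]
    [NormedSpace ℝ Y] (p σ ρ : ℝ) (hp : 0 < p) (hσ : 0 ≤ σ) (E : V → ℝ) (T : V →ₗ[ℝ] Y)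
    (N P : Y → ℝ)
    (hE0 : ∀ u, 0 ≤ E u)
    (hEh : ∀ (c : ℝ) u, E (c • u) = |c| ^ p * E u)
    (hEc : ∀ u v, E ((1/2:ℝ) • (u - v)) + E ((1/2:ℝ) • (u + v)) ≤ (E u + E v) / 2)
    (hEconv : ∀ u v, ∀ t ∈ Icc (0:ℝ) 1, E (u + t • (v - u)) ≤ (1 - t) * E u + t * E v)
    (hcont : ∀ (f : ℕ → V) u, Tendsto (fun k => E (f k - u)) atTop (𝓝 0) →
      Tendsto (fun k => E (f k)) atTop (𝓝 (E u)))
    (hT : ∀ (f : ℕ → V) u, Tendsto (fun k => E (f k - u)) atTop (𝓝 0) →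
      Tendsto (fun k => T (f k)) atTop (𝓝 (T u)))
    (hcompl : ∀ f : ℕ → V, (∀ δ > 0, ∃ K, ∀ k ≥ K, ∀ l ≥ K, E (f k - f l) < δ) →
      ∃ u, Tendsto (fun k => E (f k - u)) atTop (𝓝 0))
    (hcomp : ∀ (f : ℕ → V) (M : ℝ), (∀ k, E (f k) ≤ M) →
      ∃ φ : ℕ → ℕ, StrictMono φ ∧ ∃ y, Tendsto (fun k => T (f (φ k))) atTop (𝓝 y))
    (hNc : Continuous N) (hPc : Continuous P)
    (hNh : ∀ c : ℝ, 0 < c → ∀ y, N (c • y) = c ^ p * N y)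
    (hPh : ∀ c : ℝ, 0 < c → ∀ y, P (c • y) = c ^ p * P y)
    (hPN : ∀ y, P y ≤ N y)
    (C : Set V)
    (hCK : ∀ u ∈ C, 0 < N (T u) ∧ E u - σ * P (T u) < ρ * N (T u)) (hne : C.Nonempty)
    (hseg : ∀ u ∈ C, ∀ v, (∀ t ∈ Icc (0:ℝ) 1, 0 < N (T (u + t • (v - u))) ∧
      E (u + t • (v - u)) - σ * P (T (u + t • (v - u))) < ρ * N (T (u + t • (v - u)))) → v ∈ C) :
    ∃ u ∈ C, N (T u) = 1 ∧ ∃ d : ℝ, E u - σ * P (T u) = d ∧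
      ∀ v, ∀ᶠ t in 𝓝 (0:ℝ), d * N (T (u + t • v)) ≤ E (u + t • v) - σ * P (T (u + t • v)) := by
  -- scaling
  have hJh : ∀ c : ℝ, 0 < c → ∀ u, E (c • u) - σ * P (T (c • u)) = c ^ p * (E u - σ * P (T u)) := by
    intro c hc u
    rw [hEh, map_smul, hPh c hc, abs_of_pos hc]; ring
  have hscale : ∀ u ∈ C, ∀ c : ℝ, 0 < c → c • u ∈ C := by
    intro u hu c hc
    apply hseg u hu
    intro t ht
    have e : u + t • (c • u - u) = (1 + t * (c - 1)) • u := by module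
    have hpos : 0 < 1 + t * (c - 1) := by
      rcases lt_or_ge c 1 with h | h
      · nlinarith [ht.1, ht.2]
      · nlinarith [ht.1, ht.2]
    have hpp := Real.rpow_pos_of_pos hpos p
    rw [e, hJh _ hpos, map_smul, hNh _ hpos]
    obtain ⟨h1, h2⟩ := hCK u hu
    refine ⟨by positivity, ?_⟩
    nlinarith
  have hnorm : ∀ u ∈ C, ∃ w ∈ C, N (T w) = 1 ∧
      E w - σ * P (T w) = (E u - σ * P (T u)) / N (T u) := by
    intro u hu
    have h1 := (hCK u hu).1
    have hc : 0 < (N (T u)) ^ (-(1/p)) := Real.rpow_pos_of_pos h1 _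
    have hcp : ((N (T u)) ^ (-(1/p))) ^ p = (N (T u))⁻¹ := by
      rw [← Real.rpow_mul h1.le]
      rw [show -(1/p) * p = -1 by field_simp, Real.rpow_neg_one]
    refine ⟨_, hscale u hu _ hc, ?_, ?_⟩
    · rw [map_smul, hNh _ hc, hcp, inv_mul_cancel₀ h1.ne']
    · rw [hJh _ hc, hcp]; field_simp
  set Vals : Set ℝ := {x | ∃ w ∈ C, N (T w) = 1 ∧ E w - σ * P (T w) = x} with hV
  have hVne : Vals.Nonempty := by
    obtain ⟨u, hu⟩ := hne
    obtain ⟨w, hw, h1, h2⟩ := hnorm u hu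
    exact ⟨_, w, hw, h1, rfl⟩
  have hVb : BddBelow Vals := by
    refine ⟨-σ, ?_⟩
    rintro x ⟨w, hw, h1, rfl⟩
    have := hPN (T w); have := hE0 w
    rw [h1] at *
    nlinarith
  set d := sInf Vals with hd
  have hB : ∀ v ∈ C, d * N (T v) ≤ E v - σ * P (T v) := by
    intro v hv
    obtain ⟨w, hw, h1, h2⟩ := hnorm v hv
    have : d ≤ (E v - σ * P (T v)) / N (T v) := csInf_le hVb ⟨w, hw, h1, h2⟩
    rwa [le_div_iff₀ (hCK v hv).1] at this
  have hdρ : d < ρ := by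
    obtain ⟨u, hu⟩ := hne
    obtain ⟨w, hw, h1, h2⟩ := hnorm u hu
    have h3 := (hCK w hw).2
    have h4 : d ≤ E w - σ * P (T w) := csInf_le hVb ⟨w, hw, h1, rfl⟩
    rw [h1] at h3; linarith
  obtain ⟨x, -, hxt, hxV⟩ := exists_seq_tendsto_sInf hVne hVb
  choose f hfC hfN hfJ using hxV
  obtain ⟨M, hM⟩ := hxt.bddAbove_range
  have hEb : ∀ k, E (f k) ≤ M + σ := by
    intro k
    have h1 : x k ≤ M := hM ⟨k, rfl⟩
    have h2 := hPN (T (f k))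
    rw [hfN] at h2
    have h3 := hfJ k
    nlinarith
  obtain ⟨φ, hφ, y, hy⟩ := hcomp f _ hEb
  set g := fun k => f (φ k) with hg
  have hgJ : Tendsto (fun k => E (g k) - σ * P (T (g k))) atTop (𝓝 d) := by
    have := hxt.comp hφ.tendsto_atTop
    refine this.congr ?_
    intro k; exact (hfJ (φ k)).symm
  have hNy : N y = 1 := by
    have h1 : Tendsto (fun k => N (T (g k))) atTop (𝓝 (N y)) := (hNc.tendsto y).comp hy
    have h2 : (fun k => N (T (g k))) = fun _ => 1 := by funext k; exact hfN _
    rw [h2] at h1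
    exact tendsto_nhds_unique h1 tendsto_const_nhds
  have hball : ∀ δ > 0, ∃ η > 0, ∀ z ∈ Metric.ball y η, |N z - 1| < δ ∧ |P z - P y| < δ := by
    intro δ hδ
    have h1 : ∀ᶠ z in 𝓝 y, |N z - 1| < δ := by
      have := (hNc.tendsto y).eventually (Metric.ball_mem_nhds _ hδ)
      rw [hNy] at this
      simpa [Real.dist_eq] using this
    have h2 : ∀ᶠ z in 𝓝 y, |P z - P y| < δ := by
      have := (hPc.tendsto y).eventually (Metric.ball_mem_nhds _ hδ)
      simpa [Real.dist_eq] using this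
    exact Metric.eventually_nhds_iff_ball.1 (h1.and h2)
  have hTseg : ∀ a b : V, ∀ η > 0, T a ∈ Metric.ball y η → T b ∈ Metric.ball y η →
      ∀ t ∈ Icc (0:ℝ) 1, T (a + t • (b - a)) ∈ Metric.ball y η := by
    intro a b η hη ha hb t ht
    rw [map_add, map_smul, map_sub]
    exact (convex_ball y η).add_smul_sub_mem ha hb ht
  obtain ⟨δ₀, hδ₀, hδ1, hδ⟩ : ∃ δ > 0, δ < 1 ∧ δ * (1 + 2 * σ + |ρ|) < ρ - d := by
    have hpos : 0 < 1 + 2 * σ + |ρ| := by positivity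
    refine ⟨min (1/2) ((ρ - d) / (2 * (1 + 2 * σ + |ρ|))), ?_, ?_, ?_⟩
    · have : 0 < ρ - d := by linarith
      positivity
    · exact (min_le_left _ _).trans_lt (by norm_num)
    · calc _ ≤ ((ρ - d) / (2 * (1 + 2 * σ + |ρ|))) * (1 + 2 * σ + |ρ|) := by
            gcongr; exact min_le_right _ _
        _ = (ρ - d) / 2 := by field_simp
        _ < _ := by linarith
  obtain ⟨η₀, hη₀, hb₀⟩ := hball δ₀ hδ₀
  have hA : ∀ a b : V, T a ∈ Metric.ball y η₀ → T b ∈ Metric.ball y η₀ →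
      E a - σ * P (T a) < d + δ₀ → E b - σ * P (T b) < d + δ₀ → ∀ t ∈ Icc (0:ℝ) 1,
      0 < N (T (a + t • (b - a))) ∧
      E (a + t • (b - a)) - σ * P (T (a + t • (b - a))) < ρ * N (T (a + t • (b - a))) := by
    intro a b ha hb hJa hJb t ht
    have hh := hb₀ _ (hTseg a b η₀ hη₀ ha hb t ht)
    have ha' := (hb₀ _ ha).2
    have hb' := (hb₀ _ hb).2
    have hc := hEconv a b t ht
    generalize N (T (a + t • (b - a))) = n1 at *
    generalize P (T (a + t • (b - a))) = p1 at *
    generalize E (a + t • (b - a)) = e1 at *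
    obtain ⟨hh1, hh2⟩ := hh
    rw [abs_lt] at hh1 hh2 ha' hb'
    refine ⟨by linarith, ?_⟩
    have h1 : ρ - |ρ| * δ₀ ≤ ρ * n1 := by
      have : |ρ * (n1 - 1)| ≤ |ρ| * δ₀ := by
        rw [abs_mul]; gcongr; rw [abs_le]; constructor <;> linarith
      have := (abs_le.1 this).1
      linarith
    have h2 : (1 - t) * P (T a) + t * P (T b) - p1 ≤ 2 * δ₀ := by
      nlinarith [ht.1, ht.2]
    have h3 : σ * ((1 - t) * P (T a) + t * P (T b) - p1) ≤ σ * (2 * δ₀) := by gcongr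
    have h4 : (1 - t) * (E a - σ * P (T a)) + t * (E b - σ * P (T b)) ≤ d + δ₀ := by
      nlinarith [ht.1, ht.2]
    nlinarith
  have hev : ∀ δ > 0, ∀ η > 0, ∃ K, ∀ k ≥ K, T (g k) ∈ Metric.ball y η ∧
      |E (g k) - σ * P (T (g k)) - d| < δ := by
    intro δ hδ η hη
    have h1 := hy.eventually (Metric.ball_mem_nhds y hη)
    have h2 := hgJ.eventually (Metric.ball_mem_nhds d hδ)
    simp only [Metric.mem_ball, Real.dist_eq] at h2
    exact eventually_atTop.1 (h1.and h2)
  obtain ⟨K₀, hK₀⟩ := hev δ₀ hδ₀ η₀ hη₀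
  have hmid : ∀ k ≥ K₀, ∀ l ≥ K₀, (1/2:ℝ) • (g k + g l) ∈ C := by
    intro k hk l hl
    apply hseg (g k) (hfC _)
    intro t ht
    have e : g k + t • ((1/2:ℝ) • (g k + g l) - g k) = g k + (t/2) • (g l - g k) := by module
    rw [e]
    refine hA _ _ (hK₀ k hk).1 (hK₀ l hl).1 ?_ ?_ _ ⟨by linarith [ht.1], by linarith [ht.2]⟩
    · linarith [(abs_lt.1 (hK₀ k hk).2).2]
    · linarith [(abs_lt.1 (hK₀ l hl).2).2]
  have hCau : ∀ δ > 0, ∃ K, ∀ k ≥ K, ∀ l ≥ K, E (g k - g l) < δ := by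
    intro δ' hδ'
    set B : ℝ := 1 + |d| + 2 * σ with hBdef
    have hBpos : 0 < B := by positivity
    have h2p : (0:ℝ) < 2 ^ p := Real.rpow_pos_of_pos (by norm_num) _
    set δ := δ' / (2 * 2 ^ p * B) with hδdef
    have hδ : 0 < δ := by positivity
    obtain ⟨η, hη, hb⟩ := hball δ hδ
    obtain ⟨K, hK⟩ := hev δ hδ η hη
    refine ⟨max K K₀, fun k hk l hl => ?_⟩
    have hk1 := hK k (le_trans (le_max_left _ _) hk)
    have hl1 := hK l (le_trans (le_max_left _ _) hl)
    have hm := hB _ (hmid k (le_trans (le_max_right _ _) hk) l (le_trans (le_max_right _ _) hl))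
    have hmb : T ((1/2:ℝ) • (g k + g l)) ∈ Metric.ball y η := by
      have := hTseg (g k) (g l) η hη hk1.1 hl1.1 (1/2) ⟨by norm_num, by norm_num⟩
      convert this using 2
      module
    have hc := hEc (g k) (g l)
    have e1 : E (g k - g l) = 2 ^ p * E ((1/2:ℝ) • (g k - g l)) := by
      have := hEh 2 ((1/2:ℝ) • (g k - g l))
      rw [smul_smul, show (2:ℝ) * (1/2) = 1 by norm_num, one_smul] at this
      rw [this]; norm_num
    have hq := hb _ hmb
    have hPk := (hb _ hk1.1).2
    have hPl := (hb _ hl1.1).2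
    have hJk := hk1.2
    have hJl := hl1.2
    rw [e1]
    generalize E ((1/2:ℝ) • (g k - g l)) = em at *
    generalize E ((1/2:ℝ) • (g k + g l)) = ep at *
    generalize N (T ((1/2:ℝ) • (g k + g l))) = n1 at *
    generalize P (T ((1/2:ℝ) • (g k + g l))) = p1 at *
    obtain ⟨hh1, hh2⟩ := hq
    rw [abs_lt] at hh2 hPk hPl hJk hJl
    have h1 : d - |d| * δ ≤ d * n1 := by
      have : |d * (n1 - 1)| ≤ |d| * δ := by
        rw [abs_mul]; gcongr
      have := (abs_le.1 this).1
      linarith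
    have h3 : σ * ((P (T (g k)) + P (T (g l))) / 2 - p1) ≤ σ * (2 * δ) := by
      gcongr; linarith
    have h4 : em ≤ B * δ := by
      rw [hBdef]; nlinarith
    calc 2 ^ p * em ≤ 2 ^ p * (B * δ) := by gcongr
      _ = δ' / 2 := by rw [hδdef]; field_simp
      _ < δ' := by linarith
  obtain ⟨u, hu⟩ := hcompl g hCau
  have hTu : T u = y := tendsto_nhds_unique (hT g u hu) hy
  have hNu : N (T u) = 1 := by rw [hTu, hNy]
  have hJu : E u - σ * P (T u) = d := by
    have h1 := hcont g u hu
    have h2 : Tendsto (fun k => P (T (g k))) atTop (𝓝 (P y)) := (hPc.tendsto y).comp hy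
    have h3 := h1.sub (h2.const_mul σ)
    rw [hTu]
    exact tendsto_nhds_unique h3 hgJ
  have huC : u ∈ C := by
    apply hseg (g K₀) (hfC _)
    refine hA _ _ (hK₀ K₀ le_rfl).1 ?_ ?_ ?_
    · rw [hTu]; exact Metric.mem_ball_self hη₀
    · linarith [(abs_lt.1 (hK₀ K₀ le_rfl).2).2]
    · rw [hJu]; linarith
  refine ⟨u, huC, hNu, d, hJu, fun v => ?_⟩
  -- openness
  have hEl : Tendsto (fun t : ℝ => E (u + t • v)) (𝓝 0) (𝓝 (E u)) := by
    rw [tendsto_iff_seq_tendsto]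
    intro τ hτ
    apply hcont
    have : (fun k => E (u + τ k • v - u)) = fun k => |τ k| ^ p * E v := by
      funext k; rw [add_sub_cancel_left, hEh]
    rw [this]
    have h0 : Tendsto (fun k => |τ k| ^ p) atTop (𝓝 0) := by
      have h1 : Tendsto (fun k => |τ k|) atTop (𝓝 0) := by simpa using hτ.abs
      have := h1.rpow_const (p := p) (Or.inr hp.le)
      rwa [Real.zero_rpow hp.ne'] at this
    simpa using h0.mul_const (E v)
  have hTl : Tendsto (fun t : ℝ => T (u + t • v)) (𝓝 0) (𝓝 (T u)) := by
    have : Continuous fun t : ℝ => T u + t • T v := by fun_prop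
    have := this.tendsto 0
    simpa using this
  have hNl := (hNc.tendsto _).comp hTl
  have hPl := (hPc.tendsto _).comp hTl
  have e1 : ∀ᶠ t in 𝓝 (0:ℝ), 0 < N (T (u + t • v)) := by
    apply hNl.eventually (lt_mem_nhds _); rw [hNu]; norm_num
  have e2 : ∀ᶠ t in 𝓝 (0:ℝ), E (u + t • v) - σ * P (T (u + t • v)) < ρ * N (T (u + t • v)) := by
    refine (hEl.sub (hPl.const_mul σ)).eventually_lt (hNl.const_mul ρ) ?_
    exact (hCK u huC).2
  obtain ⟨τ, hτ, hball'⟩ := Metric.eventually_nhds_iff_ball.1 (e1.and e2)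
  filter_upwards [Metric.ball_mem_nhds (0:ℝ) hτ] with t ht
  apply hB
  apply hseg u huC
  intro a ha
  have e : u + a • (u + t • v - u) = u + (a * t) • v := by module
  rw [e]
  apply hball'
  simp only [Metric.mem_ball, dist_zero_right, Real.norm_eq_abs, abs_mul] at ht ⊢
  rw [abs_of_nonneg ha.1]
  nlinarith [abs_nonneg t, ha.1, ha.2]

section general
variable {T : Type*} [MeasurableSpace T] {μ : Measure T} {p : ℝ}

theorem g_int (hp : 2 ≤ p) {f : T → ℝ} (hf : MemLp f (ENNReal.ofReal p) μ) :
    Integrable (fun x => |f x| ^ p) μ := by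
  have := hf.integrable_norm_rpow (by simp; linarith) ENNReal.ofReal_ne_top
  rwa [ENNReal.toReal_ofReal (by linarith)] at this

theorem g_memLp (hp : 2 ≤ p) {f : T → ℝ} (hm : AEStronglyMeasurable f μ)
    (hf : Integrable (fun x => |f x| ^ p) μ) : MemLp f (ENNReal.ofReal p) μ := by
  rw [← integrable_norm_rpow_iff hm (by simp; linarith) ENNReal.ofReal_ne_top]
  rwa [ENNReal.toReal_ofReal (by linarith)]

theorem g_norm (hp : 2 ≤ p) (y : Lp ℝ (ENNReal.ofReal p) μ) :
    ‖y‖ ^ p = ∫ x, |y x| ^ p ∂μ := by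
  have h0 : 0 ≤ ∫ x, |y x| ^ p ∂μ := integral_nonneg fun x => by positivity
  rw [Lp.norm_def, (Lp.memLp y).eLpNorm_eq_integral_rpow_norm (by simp; linarith)
    ENNReal.ofReal_ne_top, ENNReal.toReal_ofReal (r := p) (by linarith)]
  simp only [Real.norm_eq_abs]
  rw [ENNReal.toReal_ofReal (by positivity), ← Real.rpow_mul h0,
    inv_mul_cancel₀ (by linarith), Real.rpow_one]

theorem g_norm' (hp : 2 ≤ p) {f : T → ℝ} (hf : MemLp f (ENNReal.ofReal p) μ) :
    ‖hf.toLp f‖ ^ p = ∫ x, |f x| ^ p ∂μ := by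
  rw [g_norm hp]
  apply integral_congr_ae
  filter_upwards [hf.coeFn_toLp] with x hx
  rw [hx]

theorem conv_pow (hp : 1 ≤ p) (x y a b : ℝ) (hx : 0 ≤ x) (hy : 0 ≤ y) (ha : 0 ≤ a) (hb : 0 ≤ b)
    (hab : a + b = 1) : (a * x + b * y) ^ p ≤ a * x ^ p + b * y ^ p := by
  have h := convexOn_rpow (p := p) hp
  have h2 := h.2 (show x ∈ Ici 0 from hx) (show y ∈ Ici 0 from hy) ha hb hab
  simpa only [smul_eq_mul] using h2

theorem clarkson_real (hp : 2 ≤ p) (a b : ℝ) :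
    |1/2 * (a - b)| ^ p + |1/2 * (a + b)| ^ p ≤ (|a| ^ p + |b| ^ p) / 2 := by
  have e : ∀ x : ℝ, |x| ^ p = (x ^ 2) ^ (p / 2) := by
    intro x
    rw [← sq_abs, ← Real.rpow_natCast, ← Real.rpow_mul (abs_nonneg x)]
    congr 1; push_cast; ring
  rw [e, e, e, e]
  refine (Real.add_rpow_le_rpow_add (sq_nonneg _) (sq_nonneg _) (by linarith)).trans ?_
  have h := conv_pow (p := p/2) (by linarith) (a^2) (b^2) (1/2) (1/2)
    (sq_nonneg _) (sq_nonneg _) (by norm_num) (by norm_num) (by norm_num)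
  have e2 : (1/2 * (a - b)) ^ 2 + (1/2 * (a + b)) ^ 2 = 1/2 * a^2 + 1/2 * b^2 := by ring
  rw [e2]; linarith

theorem conv_real (hp : 2 ≤ p) (a b t : ℝ) (ht : t ∈ Icc (0:ℝ) 1) :
    |a + t * (b - a)| ^ p ≤ (1 - t) * |a| ^ p + t * |b| ^ p := by
  have h := conv_pow (p := p) (by linarith) |a| |b| (1 - t) t
    (abs_nonneg _) (abs_nonneg _) (by linarith [ht.2]) ht.1 (by ring)
  refine le_trans (Real.rpow_le_rpow (abs_nonneg _) ?_ (by linarith)) h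
  calc |a + t * (b - a)| = |(1 - t) * a + t * b| := by congr 1; ring
    _ ≤ _ := by
      refine (abs_add_le _ _).trans ?_
      rw [abs_mul, abs_mul, abs_of_nonneg ht.1, abs_of_nonneg (by linarith [ht.2] : 0 ≤ 1 - t)]

theorem two_real (hp : 2 ≤ p) (a b : ℝ) (ha : 0 ≤ a) (hb : 0 ≤ b) :
    (a + b) ^ p ≤ 2 ^ p * (a ^ p + b ^ p) := by
  have h := conv_pow (p := p) (by linarith) a b (1/2) (1/2) ha hb (by norm_num) (by norm_num)
    (by norm_num)
  have e : a + b = 2 * (1/2 * a + 1/2 * b) := by ring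
  rw [e, Real.mul_rpow (by norm_num) (by positivity)]
  have h1 : 0 ≤ a ^ p := by positivity
  have h2 : 0 ≤ b ^ p := by positivity
  gcongr
  linarith

theorem clarkson_int (hp : 2 ≤ p) {f g : T → ℝ} (hf : MemLp f (ENNReal.ofReal p) μ)
    (hg : MemLp g (ENNReal.ofReal p) μ) :
    (∫ x, |1/2 * (f x - g x)| ^ p ∂μ) + (∫ x, |1/2 * (f x + g x)| ^ p ∂μ)
      ≤ ((∫ x, |f x| ^ p ∂μ) + ∫ x, |g x| ^ p ∂μ) / 2 := by
  have h1 := g_int hp ((hf.sub hg).const_mul (1/2))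
  have h2 := g_int hp ((hf.add hg).const_mul (1/2))
  simp only [Pi.sub_apply, Pi.add_apply] at h1 h2
  rw [← integral_add h1 h2, ← integral_add (g_int hp hf) (g_int hp hg), ← integral_div]
  exact integral_mono (h1.add h2) (((g_int hp hf).add (g_int hp hg)).div_const 2)
    fun x => clarkson_real hp _ _

theorem conv_int (hp : 2 ≤ p) {f g : T → ℝ} (hf : MemLp f (ENNReal.ofReal p) μ)
    (hg : MemLp g (ENNReal.ofReal p) μ) (t : ℝ) (ht : t ∈ Icc (0:ℝ) 1) :
    (∫ x, |f x + t * (g x - f x)| ^ p ∂μ)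
      ≤ (1 - t) * (∫ x, |f x| ^ p ∂μ) + t * ∫ x, |g x| ^ p ∂μ := by
  have h1 := g_int hp (hf.add ((hg.sub hf).const_mul t))
  simp only [Pi.sub_apply, Pi.add_apply] at h1
  rw [← integral_const_mul, ← integral_const_mul,
    ← integral_add ((g_int hp hf).const_mul _) ((g_int hp hg).const_mul _)]
  exact integral_mono h1 (((g_int hp hf).const_mul _).add ((g_int hp hg).const_mul _))
    fun x => conv_real hp _ _ _ ht

theorem hom_int {f : T → ℝ} (c : ℝ) :
    (∫ x, |c * f x| ^ p ∂μ) = |c| ^ p * ∫ x, |f x| ^ p ∂μ := by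
  rw [← integral_const_mul]
  congr 1; funext x
  rw [abs_mul, Real.mul_rpow (abs_nonneg _) (abs_nonneg _)]

theorem deriv_pos_real (hp : 2 ≤ p) (x : ℝ) :
    HasDerivAt (fun x : ℝ => (max x 0) ^ p) (p * (max x 0) ^ (p - 1)) x := by
  rcases lt_trichotomy x 0 with h | h | h
  · have h1 : (fun x : ℝ => (max x 0) ^ p) =ᶠ[𝓝 x] fun _ => 0 := by
      filter_upwards [gt_mem_nhds h] with y hy
      rw [max_eq_right hy.le, Real.zero_rpow (by linarith)]
    rw [max_eq_right h.le, Real.zero_rpow (by linarith), mul_zero]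
    exact (hasDerivAt_const x 0).congr_of_eventuallyEq h1
  · subst h
    rw [max_self, Real.zero_rpow (by linarith), mul_zero]
    have h1 := hasDerivAt_abs_rpow 0 (p := p) (by linarith)
    simp only [mul_zero] at h1
    rw [hasDerivAt_iff_isLittleO] at h1 ⊢
    refine Asymptotics.IsBigO.trans_isLittleO ?_ h1
    refine Asymptotics.IsBigO.of_bound 1 (Eventually.of_forall fun y => ?_)
    have hz : (0:ℝ) ^ p = 0 := Real.zero_rpow (by linarith)
    simp only [max_self, hz, abs_zero, smul_zero, sub_zero, one_mul, Real.norm_eq_abs]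
    rw [abs_of_nonneg (by positivity), abs_of_nonneg (by positivity)]
    exact Real.rpow_le_rpow (by positivity) (max_le (le_abs_self y) (abs_nonneg y)) (by linarith)
  · have h1 : (fun x : ℝ => (max x 0) ^ p) =ᶠ[𝓝 x] fun x => x ^ p := by
      filter_upwards [lt_mem_nhds h] with y hy
      rw [max_eq_left hy.le]
    rw [max_eq_left h.le]
    exact (Real.hasDerivAt_rpow_const (Or.inl h.ne')).congr_of_eventuallyEq h1

/-- Differentiating the integral of `F (f + t g)` when `F` has a `(p-1)`-growth derivative. -/
theorem deriv_int_gen (hp : 2 ≤ p) (F F' : ℝ → ℝ) (hF : ∀ x, HasDerivAt F (F' x) x)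
    (hF'c : Continuous F') (hF' : ∀ x, |F' x| ≤ p * |x| ^ (p - 1)) (hFb : ∀ x, |F x| ≤ |x| ^ p)
    {f g : T → ℝ} (hf : MemLp f (ENNReal.ofReal p) μ)
    (hg : MemLp g (ENNReal.ofReal p) μ) :
    HasDerivAt (fun t : ℝ => ∫ x, F (f x + t * g x) ∂μ) (∫ x, F' (f x) * g x ∂μ) 0 := by
  have hFc : Continuous F := continuous_iff_continuousAt.2 fun x => (hF x).continuousAt
  have hm : ∀ t : ℝ, AEStronglyMeasurable (fun x => f x + t * g x) μ := fun t =>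
    hf.1.add (hg.1.const_mul t)
  have key := hasDerivAt_integral_of_dominated_loc_of_deriv_le (μ := μ) (𝕜 := ℝ)
    (F := fun t x => F (f x + t * g x)) (F' := fun t x => F' (f x + t * g x) * g x)
    (x₀ := 0) (s := Metric.ball 0 1) (bound := fun x => p * (|f x| + |g x|) ^ p)
    (Metric.ball_mem_nhds _ one_pos) ?_ ?_ ?_ ?_ ?_ ?_
  · simpa using key.2
  · exact Eventually.of_forall fun t => hFc.comp_aestronglyMeasurable (hm t)
  · refine Integrable.mono' (g_int hp hf) ?_ ?_
    · exact hFc.comp_aestronglyMeasurable (hm 0)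
    · exact Eventually.of_forall fun x => by simpa using hFb (f x)
  · exact (hF'c.comp_aestronglyMeasurable (hm 0)).mul hg.1
  · refine Eventually.of_forall fun x t ht => ?_
    simp only [Metric.mem_ball, dist_zero_right, Real.norm_eq_abs] at ht
    have h1 : |f x + t * g x| ≤ |f x| + |g x| := by
      refine (abs_add_le _ _).trans ?_
      rw [abs_mul]; nlinarith [abs_nonneg (g x)]
    rw [Real.norm_eq_abs, abs_mul]
    rcases eq_or_lt_of_le (abs_nonneg (g x)) with h0 | h0
    · rw [← h0, mul_zero]; positivity
    have hpos : 0 < |f x| + |g x| := by positivity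
    calc |F' (f x + t * g x)| * |g x| ≤ (p * (|f x| + |g x|) ^ (p - 1)) * (|f x| + |g x|) := by
          gcongr
          · refine (hF' _).trans ?_
            gcongr
            linarith
          · linarith [abs_nonneg (f x)]
      _ = p * (|f x| + |g x|) ^ p := by
          rw [mul_assoc, ← Real.rpow_add_one hpos.ne']; simp
  · have := (g_int hp (hf.norm.add hg.norm)).const_mul p
    refine this.congr (Eventually.of_forall fun x => ?_)
    simp only [Pi.add_apply, Real.norm_eq_abs]
    rw [abs_of_nonneg (a := |f x| + |g x|) (by positivity)]
  · refine Eventually.of_forall fun x t _ => ?_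
    have h1 : HasDerivAt (fun t : ℝ => f x + t * g x) (g x) t := by
      simpa using ((hasDerivAt_id t).mul_const (g x)).const_add (f x)
    exact (hF _).comp t h1

theorem abs_pow_mul (hp : 2 ≤ p) (x : ℝ) : |(|x| ^ (p - 2) * x)| = |x| ^ (p - 1) := by
  rw [abs_mul, abs_of_nonneg (a := |x| ^ (p-2)) (by positivity)]
  rcases eq_or_lt_of_le (abs_nonneg x) with h0 | h0
  · rw [← h0, mul_zero, Real.zero_rpow (by linarith)]
  · rw [← Real.rpow_add_one h0.ne']; congr 1; ring

theorem deriv_int_abs (hp : 2 ≤ p) {f g : T → ℝ} (hf : MemLp f (ENNReal.ofReal p) μ)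
    (hg : MemLp g (ENNReal.ofReal p) μ) :
    HasDerivAt (fun t : ℝ => ∫ x, |f x + t * g x| ^ p ∂μ)
      (p * ∫ x, |f x| ^ (p - 2) * f x * g x ∂μ) 0 := by
  have := deriv_int_gen hp (fun x => |x| ^ p) (fun x => p * |x| ^ (p - 2) * x)
    (fun x => hasDerivAt_abs_rpow x (by linarith)) ?_ ?_ ?_ hf hg
  · rw [← integral_const_mul]
    refine this.congr_deriv ?_
    congr 1; funext x; ring
  · refine Continuous.mul (continuous_const.mul ?_) continuous_id
    exact continuous_abs.rpow_const fun x => Or.inr (by linarith)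
  · intro x
    rw [mul_assoc, abs_mul, abs_pow_mul hp, abs_of_nonneg (by linarith : 0 ≤ p)]
  · intro x; rw [abs_of_nonneg (by positivity)]

theorem deriv_int_pos (hp : 2 ≤ p) {f g : T → ℝ} (hf : MemLp f (ENNReal.ofReal p) μ)
    (hg : MemLp g (ENNReal.ofReal p) μ) :
    HasDerivAt (fun t : ℝ => ∫ x, (max (f x + t * g x) 0) ^ p ∂μ)
      (p * ∫ x, (max (f x) 0) ^ (p - 1) * g x ∂μ) 0 := by
  have hmax : ∀ x : ℝ, max x 0 ≤ |x| := fun x => max_le (le_abs_self x) (abs_nonneg x)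
  have := deriv_int_gen hp (fun x => (max x 0) ^ p) (fun x => p * (max x 0) ^ (p - 1))
    (fun x => deriv_pos_real hp x) ?_ ?_ ?_ hf hg
  · rw [← integral_const_mul]
    refine this.congr_deriv ?_
    congr 1; funext x; ring
  · refine continuous_const.mul ?_
    exact (continuous_id.max continuous_const).rpow_const fun x => Or.inr (by linarith)
  · intro x
    rw [abs_of_nonneg (by positivity)]
    gcongr
    · linarith
    · exact hmax x
  · intro x
    rw [abs_of_nonneg (by positivity)]
    gcongr
    exact hmax x

/-- Upper semicontinuity (including junk values) of the `p`-th power integral along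
two-dimensional families. -/
theorem usc_int (hp : 2 ≤ p) {f g : T → ℝ} (hf : MemLp f (ENNReal.ofReal p) μ)
    (hg : MemLp g (ENNReal.ofReal p) μ) (w : T → ℝ) {l : Filter ℝ} [l.IsCountablyGenerated]
    {a b : ℝ → ℝ} {a0 b0 : ℝ} (ha : Tendsto a l (𝓝 a0)) (hb : Tendsto b l (𝓝 b0))
    {δ : ℝ} (hδ : 0 < δ) :
    ∀ᶠ t in l, (∫ x, |a t * f x + b t * g x - w x| ^ p ∂μ)
      ≤ (∫ x, |a0 * f x + b0 * g x - w x| ^ p ∂μ) + δ := by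
  set h : ℝ → T → ℝ := fun t x => |a t * f x + b t * g x - w x| with hh
  set h0 : T → ℝ := fun x => |a0 * f x + b0 * g x - w x| with hh0
  have hnn : 0 ≤ ∫ x, h0 x ^ p ∂μ := integral_nonneg fun x => by positivity
  set G : Set ℝ := {t | Integrable (fun x => h t x ^ p) μ} with hG
  set l' := l ⊓ 𝓟 G with hl'
  suffices H : ∀ᶠ t in l', (∫ x, h t x ^ p ∂μ) ≤ (∫ x, h0 x ^ p ∂μ) + δ by
    rw [hl', eventually_inf_principal] at H
    filter_upwards [H] with t ht
    by_cases htG : t ∈ G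
    · exact ht htG
    · rw [integral_undef htG]; linarith
  rcases eq_or_neBot l' with hbot | hne
  · rw [hbot]; exact eventually_bot
  have hGl : ∀ᶠ t in l', t ∈ G := by
    rw [hl', eventually_inf_principal]; exact Eventually.of_forall fun t ht => ht
  have ha' : Tendsto a l' (𝓝 a0) := ha.mono_left inf_le_left
  have hb' : Tendsto b l' (𝓝 b0) := hb.mono_left inf_le_left
  have hpt : ∀ x, Tendsto (fun t => h t x) l' (𝓝 (h0 x)) := fun x =>
    (((ha'.mul_const _).add (hb'.mul_const _)).sub_const _).abs
  have hpt' : ∀ x, Tendsto (fun t => h t x ^ p) l' (𝓝 (h0 x ^ p)) := fun x =>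
    (hpt x).rpow_const (Or.inr (by linarith))
  have hclose : ∀ᶠ t in l', |a t - a0| < 1 ∧ |b t - b0| < 1 := by
    have h1 := ha'.eventually (Metric.ball_mem_nhds _ one_pos)
    have h2 := hb'.eventually (Metric.ball_mem_nhds _ one_pos)
    simpa [Real.dist_eq] using h1.and h2
  have hroot : ∀ t x, (h t x ^ p) ^ (p⁻¹) = h t x := fun t x =>
    Real.rpow_rpow_inv (abs_nonneg _) (by linarith)
  have hmeas : ∀ t ∈ G, AEStronglyMeasurable (h t) μ := by
    intro t ht
    have := (ht.1.aemeasurable.pow_const (p⁻¹)).aestronglyMeasurable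
    refine this.congr (Eventually.of_forall fun x => hroot t x)
  -- `h0 ^ p` measurable
  have hm0 : AEStronglyMeasurable h0 μ := by
    obtain ⟨τ, hτ⟩ := l'.exists_seq_tendsto
    obtain ⟨N, hN⟩ := eventually_atTop.1 (hτ.eventually hGl)
    refine aestronglyMeasurable_of_tendsto_ae (u := atTop) (f := fun k => h (τ (k + N)))
      (fun k => hmeas _ (hN _ (by omega))) (Eventually.of_forall fun x => ?_)
    exact (hpt x).comp (hτ.comp (tendsto_add_atTop_nat N))
  have hdist : ∀ t x, |a t - a0| < 1 ∧ |b t - b0| < 1 →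
      |h t x - h0 x| ≤ |f x| + |g x| := by
    intro t x ⟨h1, h2⟩
    refine (abs_abs_sub_abs_le_abs_sub _ _).trans ?_
    have : a t * f x + b t * g x - w x - (a0 * f x + b0 * g x - w x)
      = (a t - a0) * f x + (b t - b0) * g x := by ring
    rw [this]
    refine (abs_add_le _ _).trans ?_
    rw [abs_mul, abs_mul]
    nlinarith [abs_nonneg (f x), abs_nonneg (g x)]
  have hfg : MemLp (fun x => |f x| + |g x|) (ENNReal.ofReal p) μ := hf.abs.add hg.abs
  have hL0 : MemLp h0 (ENNReal.ofReal p) μ := by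
    obtain ⟨t, htG, htc⟩ := (hGl.and hclose).exists
    have h1 : MemLp (h t) (ENNReal.ofReal p) μ := by
      apply g_memLp hp (hmeas t htG)
      refine Integrable.congr htG (Eventually.of_forall fun x => ?_)
      simp [hh]
    refine (h1.add hfg).mono hm0 (Eventually.of_forall fun x => ?_)
    have := abs_le.1 (hdist t x htc)
    simp only [Pi.add_apply, Real.norm_eq_abs]
    rw [abs_of_nonneg (abs_nonneg _ : 0 ≤ h0 x),
      abs_of_nonneg (by positivity : 0 ≤ h t x + (|f x| + |g x|))]
    linarith
  have hbound := g_int hp (hL0.add hfg)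
  have hlim := tendsto_integral_filter_of_dominated_convergence (μ := μ) (l := l')
    (F := fun t x => h t x ^ p) (f := fun x => h0 x ^ p) _ ?_ ?_ hbound
    (Eventually.of_forall hpt')
  · have := hlim.eventually (gt_mem_nhds (show _ < (∫ x, h0 x ^ p ∂μ) + δ by linarith))
    filter_upwards [this] with t ht using ht.le
  · filter_upwards [hGl] with t ht using ht.1
  · filter_upwards [hclose] with t ht
    refine Eventually.of_forall fun x => ?_
    have := abs_le.1 (hdist t x ht)
    have hnn : 0 ≤ h t x := abs_nonneg _
    rw [Real.norm_eq_abs, abs_of_nonneg (by positivity)]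
    refine Real.rpow_le_rpow hnn ?_ (by linarith)
    refine le_trans ?_ (le_abs_self _)
    simp only [Pi.add_apply]
    linarith

end general

section concrete

/-- Difference quotient numerator. -/
def Dif (u : Pt n → ℝ) (z : Pt n × Pt n) : ℝ := u z.1 - u z.2

/-- The weighted measure on `Q`. -/
def nuQ (p α : ℝ) (Ω : Set (Pt n)) : Measure (Pt n × Pt n) :=
  (volume.restrict (Qset Ω)).withDensity (fun z => ENNReal.ofReal (kern p α z))

theorem kern_nonneg (p α : ℝ) (z : Pt n × Pt n) : 0 ≤ kern p α z := by
  unfold kern; positivity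

theorem kern_meas (p α : ℝ) : Measurable (kern p α : Pt n × Pt n → ℝ) := by
  unfold kern; fun_prop

theorem int_nu (p α : ℝ) (Ω : Set (Pt n)) (F : Pt n × Pt n → ℝ) :
    ∫ z, F z ∂(nuQ p α Ω) = ∫ z in Qset Ω, F z * kern p α z := by
  unfold nuQ
  rw [integral_withDensity_eq_integral_toReal_smul₀
    (kern_meas p α).ennreal_ofReal.aemeasurable (by simp)]
  congr 1; funext z
  rw [ENNReal.toReal_ofReal (kern_nonneg p α z), smul_eq_mul, mul_comm]

theorem gagP_eq (p α : ℝ) (Ω : Set (Pt n)) (u : Pt n → ℝ) :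
    gagP p α Ω u = ∫ z, |Dif u z| ^ p ∂(nuQ p α Ω) := by
  rw [int_nu]; rfl

theorem Hform_eq (p α : ℝ) (Ω : Set (Pt n)) (u v : Pt n → ℝ) :
    Hform p α Ω u v = ∫ z, |Dif u z| ^ (p - 2) * Dif u z * Dif v z ∂(nuQ p α Ω) := by
  rw [int_nu]; rfl

theorem Dif_meas {u : Pt n → ℝ} (hu : Measurable u) : Measurable (Dif u) := by
  unfold Dif; fun_prop

/-- The space `W` as a submodule. -/
def VW (p α : ℝ) (Ω : Set (Pt n)) : Submodule ℝ (Pt n → ℝ) where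
  carrier := {u | Measurable u ∧ MemLp u (ENNReal.ofReal p) (volume.restrict Ω) ∧
    MemLp (Dif u) (ENNReal.ofReal p) (nuQ p α Ω)}
  add_mem' := by
    rintro u v ⟨h1, h2, h3⟩ ⟨k1, k2, k3⟩
    refine ⟨h1.add k1, h2.add k2, ?_⟩
    have : Dif (u + v) = Dif u + Dif v := by
      funext z; simp only [Dif, Pi.add_apply]; ring
    rw [this]; exact h3.add k3
  zero_mem' := by
    refine ⟨measurable_const, MemLp.zero, ?_⟩
    have : Dif (0 : Pt n → ℝ) = 0 := by funext z; simp [Dif]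
    rw [this]; exact MemLp.zero
  smul_mem' := by
    rintro c u ⟨h1, h2, h3⟩
    refine ⟨h1.const_smul c, h2.const_smul c, ?_⟩
    have : Dif (c • u) = c • Dif u := by
      funext z; simp only [Dif, Pi.smul_apply, smul_eq_mul]; ring
    rw [this]; exact h3.const_smul c

theorem memW_iff {p α : ℝ} (hp : 2 ≤ p) {Ω : Set (Pt n)} {u : Pt n → ℝ} :
    memW p α Ω u ↔ u ∈ VW p α Ω := by
  have hp0 : 0 ≤ p := by linarith
  unfold memW
  show _ ↔ (Measurable u ∧ MemLp u (ENNReal.ofReal p) (volume.restrict Ω) ∧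
    MemLp (Dif u) (ENNReal.ofReal p) (nuQ p α Ω))
  refine and_congr_right fun hu => ?_
  have hm1 : Measurable fun x => |u x| ^ p := by fun_prop
  have hd := Dif_meas hu
  have hm2 : Measurable fun z => |Dif u z| ^ p := by fun_prop
  have hm3 : Measurable fun z => |Dif u z| ^ p * kern p α z := hm2.mul (kern_meas p α)
  rw [ENNReal.add_lt_top]
  refine and_congr ?_ ?_
  · rw [lt_top_iff_ne_top, lintegral_ofReal_ne_top_iff_integrable hm1.aestronglyMeasurable
      (Eventually.of_forall fun x => by positivity)]
    exact ⟨fun h => g_memLp hp hu.aestronglyMeasurable h, fun h => g_int hp h⟩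
  · have e : (∫⁻ z in Qset Ω, ENNReal.ofReal (|u z.1 - u z.2| ^ p * kern p α z))
        = ∫⁻ z in Qset Ω, ENNReal.ofReal (|Dif u z| ^ p * kern p α z) := rfl
    rw [e, lt_top_iff_ne_top, lintegral_ofReal_ne_top_iff_integrable hm3.aestronglyMeasurable
      (Eventually.of_forall fun x => mul_nonneg (by positivity) (kern_nonneg p α x))]
    have e2 : Integrable (fun z => |Dif u z| ^ p) (nuQ p α Ω) ↔
        Integrable (fun z => |Dif u z| ^ p * kern p α z) (volume.restrict (Qset Ω)) := by
      unfold nuQ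
      rw [integrable_withDensity_iff (kern_meas p α).ennreal_ofReal (by simp)]
      simp only [ENNReal.toReal_ofReal (kern_nonneg p α _)]
    rw [← e2]
    exact ⟨fun h => g_memLp hp hd.aestronglyMeasurable h, fun h => g_int hp h⟩

variable {p α : ℝ} {Ω : Set (Pt n)}

/-- The embedding into `L^p(Ω)`. -/
def Phi1 (p α : ℝ) (Ω : Set (Pt n)) :
    VW p α Ω →ₗ[ℝ] Lp ℝ (ENNReal.ofReal p) (volume.restrict Ω) where
  toFun u := u.2.2.1.toLp
  map_add' _ _ := rfl
  map_smul' _ _ := rfl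

/-- The embedding into `L^p(Q)`. -/
def Phi2 (p α : ℝ) (Ω : Set (Pt n)) :
    VW p α Ω →ₗ[ℝ] Lp ℝ (ENNReal.ofReal p) (nuQ p α Ω) where
  toFun u := u.2.2.2.toLp
  map_add' u v := by
    rw [← MemLp.toLp_add]
    congr 1
    funext z; simp only [Dif, Pi.add_apply, Submodule.coe_add]; ring
  map_smul' c u := by
    rw [RingHom.id_apply, ← MemLp.toLp_const_smul]
    congr 1
    funext z; simp only [Dif, Pi.smul_apply, Submodule.coe_smul, smul_eq_mul]; ring

theorem Phi1_norm (hp : 2 ≤ p) (u : VW p α Ω) : ‖Phi1 p α Ω u‖ ^ p = lpP p Ω u :=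
  g_norm' hp u.2.2.1

theorem Phi2_norm (hp : 2 ≤ p) (u : VW p α Ω) : ‖Phi2 p α Ω u‖ ^ p = gagP p α Ω u := by
  rw [gagP_eq]; exact g_norm' hp u.2.2.2

theorem Lam_pos (hp : 2 ≤ p) : 0 < Lam n p := by
  unfold Lam
  have h1 : 0 < Real.Gamma (((n : ℝ) + p) / 2) := Real.Gamma_pos_of_pos (by positivity)
  have h2 : 0 < Real.Gamma ((p + 1) / 2) := Real.Gamma_pos_of_pos (by positivity)
  have h3 := Real.pi_pos
  positivity

theorem energy_eq (hp : 2 ≤ p) (u : VW p α Ω) :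
    energy p α Ω u = Lam n p * (1 - α) * ‖Phi2 p α Ω u‖ ^ p + ‖Phi1 p α Ω u‖ ^ p := by
  rw [Phi1_norm hp, Phi2_norm hp]; rfl

theorem Oeps_sub (Ω : Set (Pt n)) (ε : ℝ) : Oeps Ω ε ⊆ Ω := fun _ h => h.1

theorem Oeps_meas (hΩ : IsOpen Ω) (ε : ℝ) : MeasurableSet (Oeps Ω ε) := by
  have : Oeps Ω ε = Ω ∩ {x | Metric.infDist x (frontier Ω) ≤ ε} := rfl
  rw [this]
  exact hΩ.measurableSet.inter
    (isClosed_le (Metric.continuous_infDist_pt _) continuous_const).measurableSet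

theorem restr_restr (hΩ : IsOpen Ω) (ε : ℝ) :
    (volume.restrict Ω).restrict (Oeps Ω ε) = volume.restrict (Oeps Ω ε) := by
  rw [Measure.restrict_restrict (Oeps_meas hΩ ε), inter_eq_left.2 (Oeps_sub Ω ε)]

variable [Fact (1 ≤ ENNReal.ofReal p)]

/-- Restriction to the collar. -/
def RO (p ε : ℝ) (Ω : Set (Pt n)) [Fact (1 ≤ ENNReal.ofReal p)] :
    Lp ℝ (ENNReal.ofReal p) (volume.restrict Ω) →L[ℝ]
    Lp ℝ (ENNReal.ofReal p) ((volume.restrict Ω).restrict (Oeps Ω ε)) :=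
  LpToLpRestrictCLM (Pt n) ℝ ℝ (volume.restrict Ω) (ENNReal.ofReal p) (Oeps Ω ε)

def NN (p ε : ℝ) (Ω : Set (Pt n)) [Fact (1 ≤ ENNReal.ofReal p)]
    (y : Lp ℝ (ENNReal.ofReal p) (volume.restrict Ω)) : ℝ := (1 / ε) * ‖RO p ε Ω y‖ ^ p

def PP (p ε : ℝ) (Ω : Set (Pt n)) [Fact (1 ≤ ENNReal.ofReal p)]
    (y : Lp ℝ (ENNReal.ofReal p) (volume.restrict Ω)) : ℝ :=
  (1 / ε) * ‖Lp.posPart (RO p ε Ω y)‖ ^ p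

theorem NN_cont (hp : 2 ≤ p) (ε : ℝ) : Continuous (NN p ε Ω) := by
  unfold NN
  exact continuous_const.mul ((RO p ε Ω).continuous.norm.rpow_const
    fun _ => Or.inr (by linarith))

theorem PP_cont (hp : 2 ≤ p) (ε : ℝ) : Continuous (PP p ε Ω) := by
  unfold PP
  exact continuous_const.mul ((Lp.continuous_posPart.comp (RO p ε Ω).continuous).norm.rpow_const
    fun _ => Or.inr (by linarith))

theorem NN_hom (ε c : ℝ) (hc : 0 < c) (y) : NN p ε Ω (c • y) = c ^ p * NN p ε Ω y := by
  unfold NN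
  rw [map_smul, norm_smul, Real.norm_of_nonneg hc.le, Real.mul_rpow hc.le (norm_nonneg _)]
  ring

theorem posPart_smul {T : Type*} [MeasurableSpace T] {μ : Measure T} {q : ENNReal} (c : ℝ)
    (hc : 0 < c) (y : Lp ℝ q μ) : Lp.posPart (c • y) = c • Lp.posPart y := by
  apply Lp.ext
  filter_upwards [Lp.coeFn_posPart (c • y), Lp.coeFn_posPart y, Lp.coeFn_smul c y,
    Lp.coeFn_smul c (Lp.posPart y)] with x h1 h2 h3 h4
  rw [h1, h3, h4, Pi.smul_apply, Pi.smul_apply, h2, smul_eq_mul, smul_eq_mul,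
    mul_max_of_nonneg _ _ hc.le, mul_zero]

theorem PP_hom (ε c : ℝ) (hc : 0 < c) (y) : PP p ε Ω (c • y) = c ^ p * PP p ε Ω y := by
  unfold PP
  rw [map_smul, posPart_smul c hc, norm_smul, Real.norm_of_nonneg hc.le,
    Real.mul_rpow hc.le (norm_nonneg _)]
  ring

theorem PP_le (hp : 2 ≤ p) (ε : ℝ) (hε : 0 < ε) (y) : PP p ε Ω y ≤ NN p ε Ω y := by
  unfold PP NN
  have h : ‖Lp.posPart (RO p ε Ω y)‖ ≤ ‖RO p ε Ω y‖ := by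
    apply Lp.norm_le_norm_of_ae_le
    filter_upwards [Lp.coeFn_posPart (RO p ε Ω y)] with x hx
    rw [hx, Real.norm_eq_abs, Real.norm_eq_abs, abs_of_nonneg (le_max_right _ _)]
    exact max_le (le_abs_self _) (abs_nonneg _)
  gcongr

theorem RO_ae (ε : ℝ) (u : VW p α Ω) :
    RO p ε Ω (Phi1 p α Ω u) =ᵐ[(volume.restrict Ω).restrict (Oeps Ω ε)] (u : Pt n → ℝ) := by
  have h1 := LpToLpRestrictCLM_coeFn (F := ℝ) ℝ (Oeps Ω ε) (Phi1 p α Ω u)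
  have h2 : Phi1 p α Ω u =ᵐ[volume.restrict Ω] (u : Pt n → ℝ) := u.2.2.1.coeFn_toLp
  exact h1.trans (ae_restrict_of_ae h2)

theorem NN_eq (hp : 2 ≤ p) (hΩ : IsOpen Ω) (ε : ℝ) (u : VW p α Ω) :
    NN p ε Ω (Phi1 p α Ω u) = (1 / ε) * ∫ x in Oeps Ω ε, |(u : Pt n → ℝ) x| ^ p := by
  unfold NN
  rw [g_norm hp, ← restr_restr hΩ]
  congr 1
  apply integral_congr_ae
  filter_upwards [RO_ae ε u] with x hx
  rw [hx]

theorem PP_eq (hp : 2 ≤ p) (hΩ : IsOpen Ω) (ε : ℝ) (u : VW p α Ω) :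
    PP p ε Ω (Phi1 p α Ω u) = (1 / ε) * ∫ x in Oeps Ω ε, pPart u x ^ p := by
  unfold PP
  rw [g_norm hp, ← restr_restr hΩ]
  congr 1
  apply integral_congr_ae
  filter_upwards [RO_ae ε u, Lp.coeFn_posPart (RO p ε Ω (Phi1 p α Ω u))] with x hx hx2
  rw [hx2, hx, pPart, abs_of_nonneg (le_max_right _ _)]

end concrete

section compl
variable {p α : ℝ} {Ω : Set (Pt n)}

theorem energy_hom (c : ℝ) (u : VW p α Ω) :
    energy p α Ω (c • u : VW p α Ω) = |c| ^ p * energy p α Ω u := by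
  unfold energy
  rw [gagP_eq, gagP_eq]
  have e1 : lpP p Ω (c • u : VW p α Ω) = |c| ^ p * lpP p Ω u := hom_int c
  have e2 : Dif ((c • u : VW p α Ω) : Pt n → ℝ) = fun z => c * Dif u z := by
    funext z; simp only [Dif, Pi.smul_apply, Submodule.coe_smul, smul_eq_mul]; ring
  rw [e1, e2, hom_int c]; ring

theorem kappa_pos (hp : 2 ≤ p) (hα : α < 1) : 0 < Lam n p * (1 - α) :=
  mul_pos (Lam_pos hp) (by linarith)

theorem lpP_nonneg (u : Pt n → ℝ) : 0 ≤ lpP p Ω u := integral_nonneg fun x => by positivity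
theorem gagP_nonneg (u : Pt n → ℝ) : 0 ≤ gagP p α Ω u := by
  rw [gagP_eq]; exact integral_nonneg fun x => by positivity

theorem energy_nonneg (hp : 2 ≤ p) (hα : α < 1) (u : Pt n → ℝ) : 0 ≤ energy p α Ω u := by
  unfold energy
  have := kappa_pos (n := n) hp hα
  have := lpP_nonneg (p := p) (Ω := Ω) u
  have := gagP_nonneg (p := p) (α := α) (Ω := Ω) u
  positivity

theorem energy_clarkson (hp : 2 ≤ p) (hα : α < 1) (u v : VW p α Ω) :
    energy p α Ω ((1/2:ℝ) • (u - v) : VW p α Ω) + energy p α Ω ((1/2:ℝ) • (u + v) : VW p α Ω)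
      ≤ (energy p α Ω u + energy p α Ω v) / 2 := by
  have hk := kappa_pos (n := n) hp hα
  have h1 := clarkson_int hp u.2.2.1 v.2.2.1
  have h2 := clarkson_int hp u.2.2.2 v.2.2.2
  have e1 : Dif (((1/2:ℝ) • (u - v) : VW p α Ω) : Pt n → ℝ)
      = fun z => 1/2 * (Dif u z - Dif v z) := by
    funext z
    simp only [Dif, Pi.smul_apply, Submodule.coe_smul, smul_eq_mul, Submodule.coe_sub,
      Pi.sub_apply]; ring
  have e2 : Dif (((1/2:ℝ) • (u + v) : VW p α Ω) : Pt n → ℝ)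
      = fun z => 1/2 * (Dif u z + Dif v z) := by
    funext z
    simp only [Dif, Pi.smul_apply, Submodule.coe_smul, smul_eq_mul, Submodule.coe_add,
      Pi.add_apply]; ring
  have e3 : lpP p Ω ((1/2:ℝ) • (u - v) : VW p α Ω)
    = ∫ x in Ω, |1/2 * ((u : Pt n → ℝ) x - (v : Pt n → ℝ) x)| ^ p := rfl
  have e4 : lpP p Ω ((1/2:ℝ) • (u + v) : VW p α Ω)
    = ∫ x in Ω, |1/2 * ((u : Pt n → ℝ) x + (v : Pt n → ℝ) x)| ^ p := rfl
  unfold energy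
  simp only [gagP_eq]
  rw [e1, e2, e3, e4]
  unfold lpP
  nlinarith [mul_le_mul_of_nonneg_left h2 hk.le]

theorem energy_convex (hp : 2 ≤ p) (hα : α < 1) (u v : VW p α Ω) (t : ℝ) (ht : t ∈ Icc (0:ℝ) 1) :
    energy p α Ω (u + t • (v - u) : VW p α Ω)
      ≤ (1 - t) * energy p α Ω u + t * energy p α Ω v := by
  have hk := kappa_pos (n := n) hp hα
  have h1 := conv_int hp u.2.2.1 v.2.2.1 t ht
  have h2 := conv_int hp u.2.2.2 v.2.2.2 t ht
  have e1 : Dif ((u + t • (v - u) : VW p α Ω) : Pt n → ℝ)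
      = fun z => Dif u z + t * (Dif v z - Dif u z) := by
    funext z
    simp only [Dif, Pi.smul_apply, Submodule.coe_smul, smul_eq_mul, Submodule.coe_sub,
      Pi.sub_apply, Submodule.coe_add, Pi.add_apply]; ring
  have e3 : lpP p Ω (u + t • (v - u) : VW p α Ω)
    = ∫ x in Ω, |(u : Pt n → ℝ) x + t * ((v : Pt n → ℝ) x - (u : Pt n → ℝ) x)| ^ p := rfl
  unfold energy
  simp only [gagP_eq]
  rw [e1, e3]
  unfold lpP
  nlinarith [mul_le_mul_of_nonneg_left h2 hk.le]

variable [Fact (1 ≤ ENNReal.ofReal p)]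

theorem tendsto_of_pow {x : ℕ → ℝ} (hp : 2 ≤ p) (hx : ∀ k, 0 ≤ x k)
    (h : Tendsto (fun k => x k ^ p) atTop (𝓝 0)) : Tendsto x atTop (𝓝 0) := by
  have h1 := h.rpow_const (p := p⁻¹) (Or.inr (by positivity))
  rw [Real.zero_rpow (by positivity)] at h1
  refine h1.congr fun k => Real.rpow_rpow_inv (hx k) (by linarith)

theorem energy_tendsto_zero_iff (hp : 2 ≤ p) (hα : α < 1) (f : ℕ → VW p α Ω) (u : VW p α Ω) :
    Tendsto (fun k => energy p α Ω (f k - u : VW p α Ω)) atTop (𝓝 0) ↔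
    Tendsto (fun k => Phi1 p α Ω (f k)) atTop (𝓝 (Phi1 p α Ω u)) ∧
    Tendsto (fun k => Phi2 p α Ω (f k)) atTop (𝓝 (Phi2 p α Ω u)) := by
  have hk := kappa_pos (n := n) hp hα
  simp only [energy_eq hp, map_sub]
  constructor
  · intro h
    constructor
    · rw [tendsto_iff_norm_sub_tendsto_zero]
      refine tendsto_of_pow hp (fun k => norm_nonneg _) ?_
      refine squeeze_zero (fun k => by positivity) (fun k => ?_) h
      have : 0 ≤ ‖Phi2 p α Ω (f k) - Phi2 p α Ω u‖ ^ p := by positivity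
      nlinarith
    · rw [tendsto_iff_norm_sub_tendsto_zero]
      refine tendsto_of_pow hp (fun k => norm_nonneg _) ?_
      have h' := h.const_mul (Lam n p * (1 - α))⁻¹
      rw [mul_zero] at h'
      refine squeeze_zero (fun k => by positivity) (fun k => ?_) h'
      have h3 : 0 ≤ ‖Phi1 p α Ω (f k) - Phi1 p α Ω u‖ ^ p := by positivity
      rw [mul_add, inv_mul_cancel_left₀ hk.ne']
      have := mul_nonneg (inv_pos.2 hk).le h3
      linarith
  · rintro ⟨h1, h2⟩
    rw [tendsto_iff_norm_sub_tendsto_zero] at h1 h2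
    have h1' := h1.rpow_const (p := p) (Or.inr (by linarith))
    have h2' := h2.rpow_const (p := p) (Or.inr (by linarith))
    rw [Real.zero_rpow (by linarith)] at h1' h2'
    simpa using (h2'.const_mul (Lam n p * (1 - α))).add h1'

theorem energy_hcont (hp : 2 ≤ p) (hα : α < 1) (f : ℕ → VW p α Ω) (u : VW p α Ω)
    (h : Tendsto (fun k => energy p α Ω (f k - u : VW p α Ω)) atTop (𝓝 0)) :
    Tendsto (fun k => energy p α Ω (f k)) atTop (𝓝 (energy p α Ω u)) := by
  obtain ⟨h1, h2⟩ := (energy_tendsto_zero_iff hp hα f u).1 h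
  simp only [energy_eq hp]
  exact ((h2.norm.rpow_const (Or.inr (by linarith))).const_mul _).add
    (h1.norm.rpow_const (Or.inr (by linarith)))

theorem cauchy_of_pow {X : Type*} [NormedAddCommGroup X] (hp : 2 ≤ p) (f : ℕ → X) (κ : ℝ)
    (hκ : 0 < κ) (e : ℕ → ℕ → ℝ) (he : ∀ k l, κ * ‖f k - f l‖ ^ p ≤ e k l)
    (h : ∀ δ > 0, ∃ K, ∀ k ≥ K, ∀ l ≥ K, e k l < δ) : CauchySeq f := by
  rw [Metric.cauchySeq_iff]
  intro δ hδ
  obtain ⟨K, hK⟩ := h (κ * δ ^ p) (by positivity)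
  refine ⟨K, fun k hk l hl => ?_⟩
  rw [dist_eq_norm]
  have h1 := (he k l).trans_lt (hK k hk l hl)
  have h2 := lt_of_mul_lt_mul_left h1 hκ.le
  exact (Real.rpow_lt_rpow_iff (norm_nonneg _) hδ.le (by linarith)).1 h2

theorem energy_compl (hp : 2 ≤ p) (hα : α < 1) (hΩo : IsOpen Ω) (hΩne : Ω.Nonempty)
    (f : ℕ → VW p α Ω)
    (h : ∀ δ > 0, ∃ K, ∀ k ≥ K, ∀ l ≥ K, energy p α Ω (f k - f l : VW p α Ω) < δ) :
    ∃ u : VW p α Ω, Tendsto (fun k => energy p α Ω (f k - u : VW p α Ω)) atTop (𝓝 0) := by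
  have hk := kappa_pos (n := n) hp hα
  have c1 : CauchySeq fun k => Phi1 p α Ω (f k) := by
    refine cauchy_of_pow hp _ 1 one_pos _ (fun k l => ?_) h
    rw [energy_eq hp, map_sub, map_sub, one_mul]
    have : 0 ≤ ‖Phi2 p α Ω (f k) - Phi2 p α Ω (f l)‖ ^ p := by positivity
    nlinarith
  have c2 : CauchySeq fun k => Phi2 p α Ω (f k) := by
    refine cauchy_of_pow hp _ _ hk _ (fun k l => ?_) h
    rw [energy_eq hp, map_sub, map_sub]
    have : 0 ≤ ‖Phi1 p α Ω (f k) - Phi1 p α Ω (f l)‖ ^ p := by positivity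
    linarith
  obtain ⟨y1, hy1⟩ := cauchySeq_tendsto_of_complete c1
  obtain ⟨y2, hy2⟩ := cauchySeq_tendsto_of_complete c2
  obtain ⟨φ, hφ, hφ1⟩ := (tendstoInMeasure_of_tendsto_Lp hy1).exists_seq_tendsto_ae
  obtain ⟨ψ, hψ, hψ2⟩ := (tendstoInMeasure_of_tendsto_Lp
    (hy2.comp hφ.tendsto_atTop)).exists_seq_tendsto_ae
  set g : ℕ → Pt n → ℝ := fun k => f (φ (ψ k)) with hg
  have ae1 : ∀ᵐ x ∂(volume.restrict Ω), Tendsto (fun k => g k x) atTop (𝓝 (y1 x)) := by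
    have h1 : ∀ᵐ x ∂(volume.restrict Ω), ∀ k, Phi1 p α Ω (f k) x = (f k : Pt n → ℝ) x :=
      ae_all_iff.2 fun k => (f k).2.2.1.coeFn_toLp
    filter_upwards [hφ1, h1] with x hx hx1
    have := hx.comp hψ.tendsto_atTop
    refine this.congr fun k => hx1 _
  have ae2 : ∀ᵐ z ∂(nuQ p α Ω), Tendsto (fun k => Dif (g k) z) atTop (𝓝 (y2 z)) := by
    have h1 : ∀ᵐ z ∂(nuQ p α Ω), ∀ k, Phi2 p α Ω (f k) z = Dif (f k) z :=
      ae_all_iff.2 fun k => (f k).2.2.2.coeFn_toLp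
    filter_upwards [hψ2, h1] with x hx hx1
    refine hx.congr fun k => hx1 _
  have ae3 : ∀ᵐ z ∂(volume.restrict (Qset Ω)), ∃ l, Tendsto (fun k => Dif (g k) z) atTop (𝓝 l) := by
    unfold nuQ at ae2
    rw [ae_withDensity_iff (kern_meas p α).ennreal_ofReal] at ae2
    filter_upwards [ae2] with z hz
    by_cases hz0 : z.1 = z.2
    · refine ⟨0, ?_⟩
      simp [Dif, hz0]
    · refine ⟨_, hz ?_⟩
      simp only [ne_eq, ENNReal.ofReal_eq_zero, not_le]
      exact Real.rpow_pos_of_pos (norm_pos_iff.2 (sub_ne_zero.2 hz0)) _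
  have ae4 : ∀ᵐ z ∂((volume.restrict Ω).prod (volume : Measure (Pt n))),
      ∃ l, Tendsto (fun k => Dif (g k) z) atTop (𝓝 l) := by
    have : (volume.restrict Ω).prod (volume : Measure (Pt n)) =
        (volume : Measure (Pt n × Pt n)).restrict (Ω ×ˢ univ) := by
      rw [Measure.volume_eq_prod, ← Measure.prod_restrict, Measure.restrict_univ]
    rw [this]
    refine ae_restrict_of_ae_restrict_of_subset ?_ ae3
    rintro ⟨x, y⟩ ⟨hx, -⟩
    simp only [Qset, mem_compl_iff, mem_prod, not_and_or, not_not]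
    exact Or.inl hx
  have ae5 := Measure.ae_ae_of_ae_prod ae4
  have hne : (ae (volume.restrict Ω)).NeBot := by
    rw [ae_neBot]
    intro h0
    rw [Measure.restrict_eq_zero] at h0
    exact (hΩo.measure_pos volume hΩne).ne' h0
  obtain ⟨x0, hx0, hx0'⟩ := (ae1.and ae5).exists
  have ae6 : ∀ᵐ y : Pt n, ∃ l, Tendsto (fun k => g k y) atTop (𝓝 l) := by
    filter_upwards [hx0'] with y ⟨l, hl⟩
    refine ⟨y1 x0 - l, ?_⟩
    refine (hx0.sub hl).congr fun k => ?_
    simp only [Dif]; ring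
  obtain ⟨u, hu, hulim⟩ := measurable_limit_of_tendsto_metrizable_ae
    (fun k => (f (φ (ψ k))).2.1.aemeasurable) ae6
  have hu1 : u =ᵐ[volume.restrict Ω] y1 := by
    filter_upwards [ae1, ae_restrict_of_ae hulim] with x h1 h2
    exact tendsto_nhds_unique h2 h1
  have hu2 : Dif u =ᵐ[nuQ p α Ω] y2 := by
    have hq1 : ∀ᵐ z : Pt n × Pt n, Tendsto (fun k => g k z.1) atTop (𝓝 (u z.1)) :=
      Measure.quasiMeasurePreserving_fst.ae hulim
    have hq2 : ∀ᵐ z : Pt n × Pt n, Tendsto (fun k => g k z.2) atTop (𝓝 (u z.2)) :=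
      Measure.quasiMeasurePreserving_snd.ae hulim
    have hac : nuQ p α Ω ≪ volume :=
      (withDensity_absolutelyContinuous _ _).trans Measure.restrict_le_self.absolutelyContinuous
    filter_upwards [ae2, hac.ae_le hq1, hac.ae_le hq2] with z h1 h2 h3
    exact tendsto_nhds_unique (h2.sub h3) h1
  have hmem : u ∈ VW p α Ω :=
    ⟨hu, (memLp_congr_ae hu1).2 (Lp.memLp y1), (memLp_congr_ae hu2).2 (Lp.memLp y2)⟩
  refine ⟨⟨u, hmem⟩, ?_⟩
  rw [energy_tendsto_zero_iff hp hα]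
  have e1 : Phi1 p α Ω ⟨u, hmem⟩ = y1 := by
    apply Lp.ext
    exact (hmem.2.1.coeFn_toLp).trans hu1
  have e2 : Phi2 p α Ω ⟨u, hmem⟩ = y2 := by
    apply Lp.ext
    exact (hmem.2.2.coeFn_toLp).trans hu2
  rw [e1, e2]
  exact ⟨hy1, hy2⟩

end compl

section compact
variable {p α : ℝ} {Ω : Set (Pt n)}

theorem tb_of_finite_dim {X : Type} [PseudoMetricSpace X] {s : Set X}
    (H : ∀ ε > (0:ℝ), ∃ (N : ℕ) (a : s → (Fin N → ℝ)) (h : ℝ), 0 < h ∧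
      Bornology.IsBounded (range a) ∧ ∀ x y : s, dist (a x) (a y) < h → dist (x : X) y < ε) :
    TotallyBounded s := by
  refine Metric.totallyBounded_of_finite_discretization fun ε hε => ?_
  obtain ⟨N, a, h, hh, hb, ha⟩ := H ε hε
  have htb : TotallyBounded (range a) := hb.isCompact_closure.totallyBounded.subset subset_closure
  obtain ⟨t, ht, hcov⟩ := Metric.totallyBounded_iff.1 htb (h / 2) (by positivity)
  have hF : ∀ x : s, ∃ y : t, dist (a x) y < h / 2 := by
    intro x
    have := hcov (mem_range_self x)
    simp only [mem_iUnion, Metric.mem_ball, exists_prop] at this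
    obtain ⟨y, hy, hd⟩ := this
    exact ⟨⟨y, hy⟩, hd⟩
  choose F hF using hF
  refine ⟨t, ht.fintype, F, fun x y hxy => ha x y ?_⟩
  have h1 := hF x
  have h2 := hF y
  rw [← hxy] at h2
  calc dist (a x) (a y) ≤ dist (a x) (F x) + dist (a y) (F x) := dist_triangle_right _ _ _
    _ < h := by linarith

/-- Jensen for averages, in `ENNReal` form. -/
theorem jensen_avg (hp : 2 ≤ p) {w : Pt n → ℝ} (hw : Measurable w) {B : Set (Pt n)}
    (hB0 : volume B ≠ 0) (hBt : volume B ≠ ⊤)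
    (hfin : (∫⁻ y in B, ENNReal.ofReal (|w y| ^ p)) ≠ ⊤) (c : ℝ) :
    ENNReal.ofReal (|c - ⨍ y in B, w y| ^ p)
      ≤ (volume B)⁻¹ * ∫⁻ y in B, ENNReal.ofReal (|c - w y| ^ p) := by
  have : IsFiniteMeasure (volume.restrict B) := ⟨by simpa using hBt.lt_top⟩
  have : NeZero (volume.restrict B) := ⟨by simpa [Measure.restrict_eq_zero] using hB0⟩
  have hm1 : Measurable fun x => |w x| ^ p := by fun_prop
  have hL : MemLp w (ENNReal.ofReal p) (volume.restrict B) := by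
    refine g_memLp hp hw.aestronglyMeasurable ?_
    exact (lintegral_ofReal_ne_top_iff_integrable hm1.aestronglyMeasurable
      (Eventually.of_forall fun x => by positivity)).1 hfin
  have h1p : (1 : ENNReal) ≤ ENNReal.ofReal p := by
    rw [← ENNReal.ofReal_one]; exact ENNReal.ofReal_le_ofReal (by linarith)
  have hL2 : MemLp (fun y => c - w y) (ENNReal.ofReal p) (volume.restrict B) :=
    (memLp_const c).sub hL
  have hconv : ConvexOn ℝ univ fun x : ℝ => |x| ^ p := by
    refine ⟨convex_univ, fun x _ y _ a b ha hb hab => ?_⟩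
    have := conv_real hp x y b ⟨hb, by linarith⟩
    have e : a • x + b • y = x + b * (y - x) := by
      simp only [smul_eq_mul]; rw [show a = 1 - b by linarith]; ring
    show |a • x + b • y| ^ p ≤ a • |x| ^ p + b • |y| ^ p
    rw [e, smul_eq_mul, smul_eq_mul, show a = 1 - b by linarith]
    exact this
  have hJ := hconv.map_average_le (μ := volume.restrict B) (f := fun y => c - w y)
    (continuous_abs.rpow_const fun x => Or.inr (by linarith)).continuousOn isClosed_univ
    (Eventually.of_forall fun _ => mem_univ _) (hL2.integrable h1p) (g_int hp hL2)
  have e1 : (⨍ y in B, (c - w y)) = c - ⨍ y in B, w y := by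
    rw [average_eq, integral_sub (integrable_const c) (hL.integrable h1p), smul_sub,
      ← average_eq, ← average_eq, average_const]
  rw [e1] at hJ
  refine (ENNReal.ofReal_le_ofReal hJ).trans ?_
  rw [average_eq, smul_eq_mul, ENNReal.ofReal_mul (by positivity),
    ofReal_integral_eq_lintegral_ofReal (g_int hp hL2)
      (Eventually.of_forall fun x => by positivity)]
  gcongr
  have hpos : 0 < (volume.restrict B).real univ := by
    simp only [Measure.real, Measure.restrict_apply_univ]
    exact ENNReal.toReal_pos hB0 hBt
  rw [ENNReal.ofReal_inv_of_pos hpos]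
  simp only [Measure.real, Measure.restrict_apply_univ]
  rw [ENNReal.ofReal_toReal hBt]

/-- Inner kernel integral. -/
def kin (p α : ℝ) (u : Pt n → ℝ) (x : Pt n) : ENNReal :=
  ∫⁻ y, ENNReal.ofReal (|Dif u (x, y)| ^ p * kern p α (x, y))

theorem kin_meas {u : Pt n → ℝ} (hu : Measurable u) : Measurable (kin p α u) := by
  have hd := Dif_meas hu
  have hk : Measurable (kern p α : Pt n × Pt n → ℝ) := kern_meas p α
  have : Measurable fun z : Pt n × Pt n => ENNReal.ofReal (|Dif u z| ^ p * kern p α z) := by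
    fun_prop
  exact this.lintegral_prod_right'

theorem gag_lint (hp : 2 ≤ p) (u : VW p α Ω) :
    ENNReal.ofReal (gagP p α Ω u) = ∫⁻ z in Qset Ω,
      ENNReal.ofReal (|Dif (u : Pt n → ℝ) z| ^ p * kern p α z) := by
  have e0 : gagP p α Ω u = ∫ z in Qset Ω, |Dif (u : Pt n → ℝ) z| ^ p * kern p α z := rfl
  have hfin : memW p α Ω u := (memW_iff hp).2 u.2
  have h2 : (∫⁻ z in Qset Ω, ENNReal.ofReal (|Dif (u : Pt n → ℝ) z| ^ p * kern p α z)) < ⊤ :=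
    (ENNReal.add_lt_top.1 hfin.2).2
  have hd : Measurable (Dif (u : Pt n → ℝ)) := Dif_meas hfin.1
  have hm2 : Measurable fun z => |Dif (u : Pt n → ℝ) z| ^ p := by fun_prop
  have hm3 : Measurable fun z => |Dif (u : Pt n → ℝ) z| ^ p * kern p α z :=
    hm2.mul (kern_meas p α)
  have hn : ∀ z, 0 ≤ |Dif (u : Pt n → ℝ) z| ^ p * kern p α z := fun x =>
    mul_nonneg (by positivity) (kern_nonneg p α x)
  rw [e0]
  exact ofReal_integral_eq_lintegral_ofReal
    ((lintegral_ofReal_ne_top_iff_integrable hm3.aestronglyMeasurable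
      (Eventually.of_forall hn)).1 h2.ne) (Eventually.of_forall hn)

theorem kin_int (hp : 2 ≤ p) (u : VW p α Ω) :
    ∫⁻ x in Ω, kin p α u x ≤ ENNReal.ofReal (gagP p α Ω u) := by
  have hd : Measurable (Dif (u : Pt n → ℝ)) := Dif_meas u.2.1
  have hm2 : Measurable fun z => |Dif (u : Pt n → ℝ) z| ^ p := by fun_prop
  have hm : Measurable fun z => ENNReal.ofReal (|Dif (u : Pt n → ℝ) z| ^ p * kern p α z) :=
    (hm2.mul (kern_meas p α)).ennreal_ofReal
  have e1 : ∫⁻ x in Ω, kin p α u x = ∫⁻ z in Ω ×ˢ univ,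
      ENNReal.ofReal (|Dif (u : Pt n → ℝ) z| ^ p * kern p α z) := by
    rw [Measure.volume_eq_prod, ← Measure.prod_restrict, Measure.restrict_univ,
      lintegral_prod _ hm.aemeasurable]
    rfl
  rw [e1, gag_lint hp u]
  apply lintegral_mono_set
  rintro ⟨x, y⟩ ⟨hx, -⟩
  simp only [Qset, mem_compl_iff, mem_prod, not_and_or, not_not]
  exact Or.inl hx

theorem lp_lint (hp : 2 ≤ p) (u : VW p α Ω) :
    ∫⁻ x in Ω, ENNReal.ofReal (|(u : Pt n → ℝ) x| ^ p) = ENNReal.ofReal (lpP p Ω u) := by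
  unfold lpP
  rw [ofReal_integral_eq_lintegral_ofReal (g_int hp u.2.2.1)
    (Eventually.of_forall fun x => by positivity)]

theorem dif_kin (hp : 2 ≤ p) (hα : 0 < α) {u : Pt n → ℝ} {S : Set (Pt n)} (hS : MeasurableSet S)
    {D : ℝ} (x : Pt n) (hx : ∀ y ∈ S, ‖x - y‖ ≤ D) :
    ∫⁻ y in S, ENNReal.ofReal (|u x - u y| ^ p)
      ≤ ENNReal.ofReal (D ^ ((n : ℝ) + p * α)) * kin p α u x := by
  have hθ : 0 ≤ (n : ℝ) + p * α := by positivity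
  unfold kin
  rw [← lintegral_const_mul' _ _ ENNReal.ofReal_ne_top]
  refine le_trans (setLIntegral_mono' hS (fun y hy => ?_)) (setLIntegral_le_lintegral S _)
  by_cases hxy : x = y
  · subst hxy
    rw [sub_self, abs_zero, Real.zero_rpow (by linarith)]; simp
  have hpos : 0 < ‖x - y‖ := norm_pos_iff.2 (sub_ne_zero.2 hxy)
  have hD : 0 < D := hpos.trans_le (hx y hy)
  rw [← ENNReal.ofReal_mul (by positivity)]
  apply ENNReal.ofReal_le_ofReal
  show |u x - u y| ^ p ≤ D ^ ((n : ℝ) + p * α) *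
    (|u x - u y| ^ p * ‖x - y‖ ^ (-((n : ℝ) + p * α)))
  rw [Real.rpow_neg hpos.le]
  have h1 : ‖x - y‖ ^ ((n : ℝ) + p * α) ≤ D ^ ((n : ℝ) + p * α) :=
    Real.rpow_le_rpow hpos.le (hx y hy) hθ
  have h2 : 0 < ‖x - y‖ ^ ((n : ℝ) + p * α) := Real.rpow_pos_of_pos hpos _
  have h3 : 0 ≤ |u x - u y| ^ p := by positivity
  calc |u x - u y| ^ p = |u x - u y| ^ p * 1 := (mul_one _).symm
    _ ≤ |u x - u y| ^ p * (D ^ ((n : ℝ) + p * α) * (‖x - y‖ ^ ((n : ℝ) + p * α))⁻¹) := by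
        gcongr
        rw [← div_eq_mul_inv, le_div_iff₀ h2, one_mul]; exact h1
    _ = _ := by ring

theorem two_ennreal (hp : 2 ≤ p) (a b : ℝ) : ENNReal.ofReal (|a + b| ^ p)
    ≤ ENNReal.ofReal (2 ^ p) * (ENNReal.ofReal (|a| ^ p) + ENNReal.ofReal (|b| ^ p)) := by
  rw [← ENNReal.ofReal_add (by positivity) (by positivity), ← ENNReal.ofReal_mul (by positivity)]
  apply ENNReal.ofReal_le_ofReal
  refine le_trans ?_ (two_real hp _ _ (abs_nonneg _) (abs_nonneg _))
  gcongr
  exact abs_add_le _ _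

/-- Local `L^p` bound near `Ω`. -/
theorem loc_bound (hp : 2 ≤ p) (hα : 0 < α) {S : Set (Pt n)} (hS : MeasurableSet S)
    {D : ℝ} (hΩm : MeasurableSet Ω) (hx : ∀ x ∈ Ω, ∀ y ∈ S, ‖x - y‖ ≤ D) (u : VW p α Ω) :
    volume Ω * ∫⁻ y in S, ENNReal.ofReal (|(u : Pt n → ℝ) y| ^ p)
      ≤ ENNReal.ofReal (2 ^ p) * (ENNReal.ofReal (D ^ ((n : ℝ) + p * α)) *
        ENNReal.ofReal (gagP p α Ω u) + volume S * ENNReal.ofReal (lpP p Ω u)) := by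
  obtain ⟨U, hU⟩ : ∃ U : Pt n → ℝ, U = u := ⟨_, rfl⟩
  rw [← hU]
  have hum : Measurable U := hU ▸ u.2.1
  have hlp := lp_lint hp u
  have hki := kin_int hp u
  rw [← hU] at hlp hki
  have hFm : Measurable fun x => ENNReal.ofReal (|U x| ^ p) := by fun_prop
  have key : ∀ x ∈ Ω, ∫⁻ y in S, ENNReal.ofReal (|U y| ^ p)
      ≤ ENNReal.ofReal (2 ^ p) * (ENNReal.ofReal (D ^ ((n : ℝ) + p * α)) * kin p α U x
        + volume S * ENNReal.ofReal (|U x| ^ p)) := by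
    intro x hxΩ
    calc ∫⁻ y in S, ENNReal.ofReal (|U y| ^ p)
        ≤ ∫⁻ y in S, ENNReal.ofReal (2 ^ p) * (ENNReal.ofReal (|U x - U y| ^ p)
          + ENNReal.ofReal (|U x| ^ p)) := by
          refine lintegral_mono fun y => ?_
          have := two_ennreal hp (-(U x - U y)) (U x)
          rw [abs_neg] at this
          convert this using 4
          ring
      _ = ENNReal.ofReal (2 ^ p) * ((∫⁻ y in S, ENNReal.ofReal (|U x - U y| ^ p))
          + volume S * ENNReal.ofReal (|U x| ^ p)) := by
          rw [lintegral_const_mul' _ _ ENNReal.ofReal_ne_top,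
            lintegral_add_right _ measurable_const, lintegral_const,
            Measure.restrict_apply_univ, mul_comm (volume S)]
      _ ≤ _ := by
          gcongr
          exact dif_kin hp hα hS x (hx x hxΩ)
  calc volume Ω * ∫⁻ y in S, ENNReal.ofReal (|U y| ^ p)
      = ∫⁻ _ in Ω, (∫⁻ y in S, ENNReal.ofReal (|U y| ^ p)) := by
        rw [setLIntegral_const, mul_comm]
    _ ≤ ∫⁻ x in Ω, ENNReal.ofReal (2 ^ p) * (ENNReal.ofReal (D ^ ((n : ℝ) + p * α)) * kin p α U x
        + volume S * ENNReal.ofReal (|U x| ^ p)) := setLIntegral_mono' hΩm key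
    _ = ENNReal.ofReal (2 ^ p) * (ENNReal.ofReal (D ^ ((n : ℝ) + p * α)) *
        (∫⁻ x in Ω, kin p α U x) + volume S * ∫⁻ x in Ω, ENNReal.ofReal (|U x| ^ p)) := by
        rw [lintegral_const_mul' _ _ ENNReal.ofReal_ne_top,
          lintegral_add_right _ (hFm.const_mul _), lintegral_const_mul' _ _ ENNReal.ofReal_ne_top,
          lintegral_const_mul _ hFm]
    _ ≤ _ := by
        rw [hlp]
        gcongr

/-- If all averages over the balls of a `δ`-net are small, `∫_Ω |w|^p` is small. -/
theorem net_bound (hp : 2 ≤ p) (hα : 0 < α) (hΩm : MeasurableSet Ω) {δ h : ℝ} (hδ : 0 < δ)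
    (hh : 0 ≤ h) {ι : Type*} (c : ι → Pt n) (hcov : ∀ x ∈ Ω, ∃ i, x ∈ Metric.ball (c i) δ)
    (w : VW p α Ω)
    (hfin : ∀ i, (∫⁻ y in Metric.ball (c i) δ, ENNReal.ofReal (|(w : Pt n → ℝ) y| ^ p)) ≠ ⊤)
    (hav : ∀ i, |⨍ y in Metric.ball (c i) δ, (w : Pt n → ℝ) y| ≤ h) :
    ENNReal.ofReal (lpP p Ω w) ≤ ENNReal.ofReal (2 ^ p) *
      ((volume (Metric.ball (0 : Pt n) δ))⁻¹ * (ENNReal.ofReal ((2 * δ) ^ ((n : ℝ) + p * α)) *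
        ENNReal.ofReal (gagP p α Ω w)) + volume Ω * ENNReal.ofReal (h ^ p)) := by
  obtain ⟨U, hU⟩ : ∃ U : Pt n → ℝ, U = w := ⟨_, rfl⟩
  rw [← hU] at hfin hav ⊢
  have hum : Measurable U := hU ▸ w.2.1
  have hlp := lp_lint hp w
  have hki := kin_int hp w
  rw [← hU] at hlp hki
  have hFm : Measurable fun x => ENNReal.ofReal (|U x| ^ p) := by fun_prop
  set v := volume (Metric.ball (0 : Pt n) δ) with hv
  have hv0 : v ≠ 0 := (Metric.measure_ball_pos volume 0 hδ).ne'
  have hvt : v ≠ ⊤ := measure_ball_lt_top.ne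
  have hvi : ∀ i, volume (Metric.ball (c i) δ) = v := fun i => by
    rw [hv, Measure.addHaar_ball_center]
  have key : ∀ x ∈ Ω, ENNReal.ofReal (|U x| ^ p) ≤ ENNReal.ofReal (2 ^ p) *
      (v⁻¹ * (ENNReal.ofReal ((2 * δ) ^ ((n : ℝ) + p * α)) * kin p α U x)
        + ENNReal.ofReal (h ^ p)) := by
    intro x hx
    obtain ⟨i, hi⟩ := hcov x hx
    set a := ⨍ y in Metric.ball (c i) δ, U y with ha
    have h1 := two_ennreal hp (U x - a) a
    rw [sub_add_cancel] at h1
    refine h1.trans ?_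
    have h2 := jensen_avg hp hum (by rw [hvi]; exact hv0) (by rw [hvi]; exact hvt) (hfin i) (U x)
    rw [hvi] at h2
    gcongr
    · refine h2.trans ?_
      gcongr
      refine dif_kin hp hα measurableSet_ball x fun y hy => ?_
      rw [← dist_eq_norm]
      have := dist_triangle_right x y (c i)
      rw [Metric.mem_ball] at hi hy
      linarith
    · exact hav i
  rw [← hlp]
  calc ∫⁻ x in Ω, ENNReal.ofReal (|U x| ^ p)
      ≤ ∫⁻ x in Ω, ENNReal.ofReal (2 ^ p) *
      (v⁻¹ * (ENNReal.ofReal ((2 * δ) ^ ((n : ℝ) + p * α)) * kin p α U x)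
        + ENNReal.ofReal (h ^ p)) := setLIntegral_mono' hΩm key
    _ = ENNReal.ofReal (2 ^ p) *
      (v⁻¹ * (ENNReal.ofReal ((2 * δ) ^ ((n : ℝ) + p * α)) * ∫⁻ x in Ω, kin p α U x)
        + volume Ω * ENNReal.ofReal (h ^ p)) := by
        rw [lintegral_const_mul' _ _ ENNReal.ofReal_ne_top,
          lintegral_add_right _ measurable_const, lintegral_const_mul' _ _ (by simp [hv0]),
          lintegral_const_mul' _ _ ENNReal.ofReal_ne_top, setLIntegral_const, mul_comm (volume Ω)]
    _ ≤ _ := by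
        gcongr

end compact

section compact2
variable {p α : ℝ} {Ω : Set (Pt n)}

theorem int_of_lp (hp : 2 ≤ p) {w : Pt n → ℝ} (hw : Measurable w) {B : Set (Pt n)}
    (hBt : volume B ≠ ⊤) (hfin : (∫⁻ y in B, ENNReal.ofReal (|w y| ^ p)) ≠ ⊤) :
    IntegrableOn w B := by
  have : IsFiniteMeasure (volume.restrict B) := ⟨by simpa using hBt.lt_top⟩
  have hm1 : Measurable fun x => |w x| ^ p := by fun_prop
  have hL : MemLp w (ENNReal.ofReal p) (volume.restrict B) := by
    refine g_memLp hp hw.aestronglyMeasurable ?_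
    exact (lintegral_ofReal_ne_top_iff_integrable hm1.aestronglyMeasurable
      (Eventually.of_forall fun x => by positivity)).1 hfin
  have h1p : (1 : ENNReal) ≤ ENNReal.ofReal p := by
    rw [← ENNReal.ofReal_one]; exact ENNReal.ofReal_le_ofReal (by linarith)
  exact hL.integrable h1p

theorem gag_sub (hp : 2 ≤ p) (u v : VW p α Ω) :
    gagP p α Ω (u - v : VW p α Ω) ≤ 2 ^ p * (gagP p α Ω u + gagP p α Ω v) := by
  have : Fact (1 ≤ ENNReal.ofReal p) := ⟨by
    rw [← ENNReal.ofReal_one]; exact ENNReal.ofReal_le_ofReal (by linarith)⟩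
  rw [← Phi2_norm hp, ← Phi2_norm hp, ← Phi2_norm hp, map_sub]
  refine le_trans ?_ (two_real hp _ _ (norm_nonneg _) (norm_nonneg _))
  exact Real.rpow_le_rpow (norm_nonneg _) (norm_sub_le _ _) (by linarith)

theorem net_bound_real (hp : 2 ≤ p) (hα : 0 < α) (hΩm : MeasurableSet Ω)
    (hΩt : volume Ω ≠ ⊤) {δ h : ℝ} (hδ : 0 < δ)
    (hh : 0 ≤ h) {ι : Type*} (c : ι → Pt n) (hcov : ∀ x ∈ Ω, ∃ i, x ∈ Metric.ball (c i) δ)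
    (w : VW p α Ω)
    (hfin : ∀ i, (∫⁻ y in Metric.ball (c i) δ, ENNReal.ofReal (|(w : Pt n → ℝ) y| ^ p)) ≠ ⊤)
    (hav : ∀ i, |⨍ y in Metric.ball (c i) δ, (w : Pt n → ℝ) y| ≤ h) :
    lpP p Ω w ≤ 2 ^ p * (((volume (Metric.ball (0 : Pt n) 1)).toReal⁻¹ *
      2 ^ ((n : ℝ) + p * α)) * δ ^ (p * α) * gagP p α Ω w + (volume Ω).toReal * h ^ p) := by
  have hb := net_bound hp hα hΩm hδ hh c hcov w hfin hav
  have hg : 0 ≤ gagP p α Ω w := gagP_nonneg _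
  obtain ⟨v1, hv1, hv1e⟩ : ∃ v1 : ℝ, 0 < v1 ∧ volume (Metric.ball (0 : Pt n) 1) = ENNReal.ofReal v1 :=
    ⟨_, ENNReal.toReal_pos (Metric.measure_ball_pos volume 0 one_pos).ne' measure_ball_lt_top.ne,
      (ENNReal.ofReal_toReal measure_ball_lt_top.ne).symm⟩
  have hv : volume (Metric.ball (0 : Pt n) δ) = ENNReal.ofReal (δ ^ n * v1) := by
    rw [Measure.addHaar_ball_of_pos _ _ hδ, hv1e, ← ENNReal.ofReal_mul (by positivity)]
    simp
  obtain ⟨V, hV, hVe⟩ : ∃ V : ℝ, 0 ≤ V ∧ volume Ω = ENNReal.ofReal V :=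
    ⟨_, ENNReal.toReal_nonneg, (ENNReal.ofReal_toReal hΩt).symm⟩
  rw [hv, hVe, ← ENNReal.ofReal_inv_of_pos (by positivity), ← ENNReal.ofReal_mul (by positivity),
    ← ENNReal.ofReal_mul (by positivity), ← ENNReal.ofReal_mul (by positivity),
    ← ENNReal.ofReal_add (by positivity) (by positivity), ← ENNReal.ofReal_mul (by positivity),
    ENNReal.ofReal_le_ofReal_iff (by positivity)] at hb
  rw [hv1e, hVe, ENNReal.toReal_ofReal hV, ENNReal.toReal_ofReal hv1.le]
  refine hb.trans (le_of_eq ?_)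
  congr 2
  rw [Real.mul_rpow (by norm_num) hδ.le, Real.rpow_add hδ, Real.rpow_natCast]
  field_simp

theorem comp_tb [Fact (1 ≤ ENNReal.ofReal p)] (hp : 2 ≤ p) (hα : 0 < α) (hΩo : IsOpen Ω)
    (hΩne : Ω.Nonempty) (hΩb : Bornology.IsBounded Ω) {M : ℝ} (hM : 0 ≤ M) :
    TotallyBounded ((Phi1 p α Ω) '' {u | lpP p Ω u ≤ M ∧ gagP p α Ω u ≤ M}) := by
  have hΩm := hΩo.measurableSet
  have hΩt : volume Ω ≠ ⊤ := hΩb.measure_lt_top.ne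
  have hΩ0 : volume Ω ≠ 0 := (hΩo.measure_pos volume hΩne).ne'
  apply tb_of_finite_dim
  intro e he
  -- choose δ and h
  obtain ⟨K, hK, hKdef⟩ : ∃ K : ℝ, 0 ≤ K ∧ K = ((volume (Metric.ball (0 : Pt n) 1)).toReal⁻¹ *
      2 ^ ((n : ℝ) + p * α)) := ⟨_, by positivity, rfl⟩
  obtain ⟨V, hV, hVdef⟩ : ∃ V : ℝ, 0 ≤ V ∧ V = (volume Ω).toReal := ⟨_, by positivity, rfl⟩
  have hep : 0 < e ^ p := Real.rpow_pos_of_pos he p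
  obtain ⟨δ, hδ, hδ1, hδe⟩ : ∃ δ : ℝ, 0 < δ ∧ δ ≤ 1 ∧
      2 ^ p * (K * δ ^ (p * α) * (2 ^ p * (M + M))) < e ^ p / 2 := by
    have hpa : 0 < p * α := by positivity
    have t1 : Tendsto (fun δ : ℝ => 2 ^ p * (K * δ ^ (p * α) * (2 ^ p * (M + M)))) (𝓝[>] 0)
        (𝓝 (2 ^ p * (K * 0 * (2 ^ p * (M + M))))) := by
      have : Tendsto (fun δ : ℝ => δ ^ (p * α)) (𝓝[>] 0) (𝓝 0) := by
        have := (Real.continuousAt_rpow_const (0:ℝ) (p * α) (Or.inr hpa.le)).tendsto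
        rw [Real.zero_rpow hpa.ne'] at this
        exact this.mono_left nhdsWithin_le_nhds
      exact ((this.const_mul K).mul_const _).const_mul _
    have t2 := t1.eventually_lt_const (u := e ^ p / 2) (by simp; positivity)
    have t3 : ∀ᶠ δ : ℝ in 𝓝[>] 0, δ ∈ Ioc (0:ℝ) 1 := Ioc_mem_nhdsGT one_pos
    obtain ⟨δ, h1, h2⟩ := (t2.and t3).exists
    exact ⟨δ, h2.1, h2.2, h1⟩
  obtain ⟨h, hh, hhe⟩ : ∃ h : ℝ, 0 < h ∧ 2 ^ p * (V * h ^ p) < e ^ p / 2 := by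
    have t1 : Tendsto (fun δ : ℝ => 2 ^ p * (V * δ ^ p)) (𝓝[>] 0)
        (𝓝 (2 ^ p * (V * 0))) := by
      have : Tendsto (fun δ : ℝ => δ ^ p) (𝓝[>] 0) (𝓝 0) := by
        have := (Real.continuousAt_rpow_const (0:ℝ) p (Or.inr (by linarith))).tendsto
        rw [Real.zero_rpow (by linarith)] at this
        exact this.mono_left nhdsWithin_le_nhds
      exact (this.const_mul V).const_mul _
    have t2 := t1.eventually_lt_const (u := e ^ p / 2) (by simp; positivity)
    have t3 : ∀ᶠ δ : ℝ in 𝓝[>] 0, δ ∈ Ioi (0:ℝ) := self_mem_nhdsWithin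
    obtain ⟨δ, h1, h2⟩ := (t2.and t3).exists
    exact ⟨δ, h2, h1⟩
  -- net
  have htb : TotallyBounded Ω := hΩb.isCompact_closure.totallyBounded.subset subset_closure
  obtain ⟨t, htΩ, htf, hcov⟩ := Metric.finite_approx_of_totallyBounded htb δ hδ
  obtain ⟨N, c, -, hc⟩ := htf.fin_param
  have hcΩ : ∀ i, c i ∈ Ω := fun i => htΩ (hc ▸ mem_range_self i)
  have hcov' : ∀ x ∈ Ω, ∃ i, x ∈ Metric.ball (c i) δ := by
    intro x hx
    have := hcov hx
    simp only [mem_iUnion, exists_prop] at this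
    obtain ⟨y, hy, hxy⟩ := this
    rw [← hc] at hy
    obtain ⟨i, rfl⟩ := hy
    exact ⟨i, hxy⟩
  -- local bounds
  obtain ⟨D, hD⟩ : ∃ D : ℝ, ∀ i, ∀ x ∈ Ω, ∀ y ∈ Metric.ball (c i) δ, ‖x - y‖ ≤ D := by
    obtain ⟨R, hR⟩ := Metric.isBounded_iff.1 hΩb
    refine ⟨R + 1, fun i x hx y hy => ?_⟩
    rw [← dist_eq_norm]
    have h1 := hR hx (hcΩ i)
    have h2 := dist_triangle_right x y (c i)
    rw [Metric.mem_ball] at hy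
    linarith
  have hvi : ∀ i, volume (Metric.ball (c i) δ) = volume (Metric.ball (0 : Pt n) δ) := fun i => by
    rw [Measure.addHaar_ball_center]
  have hv0 : volume (Metric.ball (0 : Pt n) δ) ≠ 0 := (Metric.measure_ball_pos volume 0 hδ).ne'
  have hvt : volume (Metric.ball (0 : Pt n) δ) ≠ ⊤ := measure_ball_lt_top.ne
  have hlocf : ∀ (u : VW p α Ω) i,
      (∫⁻ y in Metric.ball (c i) δ, ENNReal.ofReal (|(u : Pt n → ℝ) y| ^ p)) ≠ ⊤ := by
    intro u i
    have := loc_bound hp hα measurableSet_ball hΩm (hD i) u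
    have hfin : ENNReal.ofReal (2 ^ p) * (ENNReal.ofReal (D ^ ((n : ℝ) + p * α)) *
        ENNReal.ofReal (gagP p α Ω u) + volume (Metric.ball (c i) δ) * ENNReal.ofReal (lpP p Ω u))
        < ⊤ := by
      rw [hvi]
      exact ENNReal.mul_lt_top ENNReal.ofReal_lt_top (ENNReal.add_lt_top.2
        ⟨ENNReal.mul_lt_top ENNReal.ofReal_lt_top ENNReal.ofReal_lt_top,
          ENNReal.mul_lt_top hvt.lt_top ENNReal.ofReal_lt_top⟩)
    intro htop
    rw [htop, ENNReal.mul_top hΩ0] at this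
    exact absurd (this.trans_lt hfin) (lt_irrefl _)
  obtain ⟨R, hR⟩ : ∃ R : ENNReal, R ≠ ⊤ ∧ ∀ u : VW p α Ω, lpP p Ω u ≤ M → gagP p α Ω u ≤ M →
      ∀ i, (∫⁻ y in Metric.ball (c i) δ, ENNReal.ofReal (|(u : Pt n → ℝ) y| ^ p)) ≤ R := by
    refine ⟨(volume Ω)⁻¹ * (ENNReal.ofReal (2 ^ p) * (ENNReal.ofReal (D ^ ((n : ℝ) + p * α)) *
        ENNReal.ofReal M + volume (Metric.ball (0 : Pt n) δ) * ENNReal.ofReal M)), ?_, ?_⟩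
    · exact ENNReal.mul_ne_top (ENNReal.inv_ne_top.2 hΩ0) (ENNReal.mul_ne_top ENNReal.ofReal_ne_top
        (ENNReal.add_ne_top.2 ⟨ENNReal.mul_ne_top ENNReal.ofReal_ne_top ENNReal.ofReal_ne_top,
          ENNReal.mul_ne_top hvt ENNReal.ofReal_ne_top⟩))
    · intro u hu1 hu2 i
      have := loc_bound hp hα measurableSet_ball hΩm (hD i) u
      rw [hvi] at this
      calc (∫⁻ y in Metric.ball (c i) δ, ENNReal.ofReal (|(u : Pt n → ℝ) y| ^ p))
          = (volume Ω)⁻¹ * (volume Ω *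
            ∫⁻ y in Metric.ball (c i) δ, ENNReal.ofReal (|(u : Pt n → ℝ) y| ^ p)) := by
            rw [← mul_assoc, ENNReal.inv_mul_cancel hΩ0 hΩt, one_mul]
        _ ≤ _ := by
            refine mul_le_mul' le_rfl (this.trans ?_)
            gcongr
  obtain ⟨hRt, hR⟩ := hR
  -- representatives
  have hrep : ∀ x : ((Phi1 p α Ω) '' {u | lpP p Ω u ≤ M ∧ gagP p α Ω u ≤ M} : Set _),
      ∃ u : VW p α Ω, (lpP p Ω u ≤ M ∧ gagP p α Ω u ≤ M) ∧ Phi1 p α Ω u = x := fun x => x.2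
  choose U hUM hUx using hrep
  refine ⟨N, fun x i => ⨍ y in Metric.ball (c i) δ, (U x : Pt n → ℝ) y, h, hh, ?_, ?_⟩
  · refine isBounded_iff_forall_norm_le.2
      ⟨1 + ((volume (Metric.ball (0 : Pt n) δ))⁻¹ * R).toReal, ?_⟩
    rintro _ ⟨x, rfl⟩
    refine (pi_norm_le_iff_of_nonneg (by positivity)).2 fun i => ?_
    have h1 := jensen_avg hp (U x).2.1 (by rw [hvi]; exact hv0) (by rw [hvi]; exact hvt)
      (hlocf (U x) i) 0
    rw [hvi] at h1
    simp only [zero_sub, abs_neg] at h1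
    have h2 : ENNReal.ofReal (|⨍ y in Metric.ball (c i) δ, (U x : Pt n → ℝ) y| ^ p)
        ≤ (volume (Metric.ball (0 : Pt n) δ))⁻¹ * R := by
      refine h1.trans ?_
      gcongr
      exact hR (U x) (hUM x).1 (hUM x).2 i
    have h3 := (ENNReal.ofReal_le_iff_le_toReal
      (ENNReal.mul_ne_top (ENNReal.inv_ne_top.2 hv0) hRt)).1 h2
    have h4 : ∀ a : ℝ, |a| ≤ 1 + |a| ^ p := by
      intro a
      rcases le_total |a| 1 with ha | ha
      · have : 0 ≤ |a| ^ p := by positivity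
        linarith
      · have := Real.self_le_rpow_of_one_le ha (by linarith : 1 ≤ p)
        linarith
    rw [Real.norm_eq_abs]
    linarith [h4 (⨍ y in Metric.ball (c i) δ, (U x : Pt n → ℝ) y)]
  · intro x y hxy
    have hav : ∀ i, |⨍ z in Metric.ball (c i) δ, ((U x - U y : VW p α Ω) : Pt n → ℝ) z| ≤ h := by
      intro i
      have h1 := (dist_le_pi_dist (fun i => ⨍ z in Metric.ball (c i) δ, (U x : Pt n → ℝ) z)
        (fun i => ⨍ z in Metric.ball (c i) δ, (U y : Pt n → ℝ) z) i).trans hxy.le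
      rw [Real.dist_eq] at h1
      have hI : ∀ x, IntegrableOn (U x : Pt n → ℝ) (Metric.ball (c i) δ) := fun x =>
        int_of_lp hp (U x).2.1 (by rw [hvi]; exact hvt) (hlocf (U x) i)
      have e1 : (⨍ z in Metric.ball (c i) δ, ((U x - U y : VW p α Ω) : Pt n → ℝ) z)
          = (⨍ z in Metric.ball (c i) δ, (U x : Pt n → ℝ) z)
            - ⨍ z in Metric.ball (c i) δ, (U y : Pt n → ℝ) z := by
        rw [average_eq, average_eq, average_eq, ← smul_sub, ← integral_sub (hI x) (hI y)]
        rfl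
      rw [e1]; exact h1
    have hb := net_bound_real hp hα hΩm hΩt hδ hh.le c hcov' (U x - U y) (hlocf _) hav
    rw [← hKdef, ← hVdef] at hb
    have hg := gag_sub hp (U x) (U y)
    have hg2 : gagP p α Ω (U x - U y : VW p α Ω) ≤ 2 ^ p * (M + M) := by
      refine hg.trans ?_
      have h1 := (hUM x).2
      have h2 := (hUM y).2
      gcongr
    have hlt : lpP p Ω (U x - U y : VW p α Ω) < e ^ p := by
      have : K * δ ^ (p * α) * gagP p α Ω (U x - U y : VW p α Ω)
          ≤ K * δ ^ (p * α) * (2 ^ p * (M + M)) := by gcongr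
      have h2p : (0:ℝ) < 2 ^ p := by positivity
      nlinarith
    rw [← Phi1_norm hp, map_sub, hUx, hUx, ← dist_eq_norm] at hlt
    exact (Real.rpow_lt_rpow_iff dist_nonneg he.le (by linarith)).1 hlt

theorem energy_comp [Fact (1 ≤ ENNReal.ofReal p)] (hp : 2 ≤ p) (hα : 0 < α) (hα1 : α < 1)
    (hΩo : IsOpen Ω) (hΩne : Ω.Nonempty) (hΩb : Bornology.IsBounded Ω) (f : ℕ → VW p α Ω) (M : ℝ)
    (hf : ∀ k, energy p α Ω (f k) ≤ M) :
    ∃ φ : ℕ → ℕ, StrictMono φ ∧ ∃ y, Tendsto (fun k => Phi1 p α Ω (f (φ k))) atTop (𝓝 y) := by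
  have hk := kappa_pos (n := n) hp hα1
  have hM : 0 ≤ M := (energy_nonneg hp hα1 _).trans (hf 0)
  set M' := max M (M / (Lam n p * (1 - α))) with hM'
  have hM'0 : 0 ≤ M' := hM.trans (le_max_left _ _)
  have hc := (comp_tb hp hα hΩo hΩne hΩb hM'0).closure.isCompact_of_isClosed isClosed_closure
  have hmem : ∀ k, Phi1 p α Ω (f k) ∈
      closure ((Phi1 p α Ω) '' {u | lpP p Ω u ≤ M' ∧ gagP p α Ω u ≤ M'}) := by
    intro k
    refine subset_closure ⟨f k, ⟨?_, ?_⟩, rfl⟩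
    · have h1 := hf k
      unfold energy at h1
      have h2 := mul_nonneg hk.le (gagP_nonneg (p := p) (α := α) (Ω := Ω) (f k))
      exact le_trans (by linarith) (le_max_left _ _)
    · have h1 := hf k
      unfold energy at h1
      have h2 := lpP_nonneg (p := p) (Ω := Ω) (f k)
      refine le_trans ?_ (le_max_right _ _)
      rw [le_div_iff₀ hk]
      linarith
  obtain ⟨y, -, φ, hφ, hlim⟩ := hc.tendsto_subseq hmem
  exact ⟨φ, hφ, y, hlim⟩

end compact2

section final
variable {p α : ℝ} {Ω : Set (Pt n)}

theorem conn_abs {X : Type*} [TopologicalSpace X] {O : Set X} {x0 : X} {γ : ℝ → X}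
    (hc : ContinuousOn γ (Icc 0 1)) (hO : ∀ t ∈ Icc (0:ℝ) 1, γ t ∈ O)
    (h0 : γ 0 ∈ connectedComponentIn O x0) : γ 1 ∈ connectedComponentIn O x0 := by
  have h1 : IsPreconnected (γ '' Icc 0 1) := isPreconnected_Icc.image _ hc
  have h2 := h1.subset_connectedComponentIn (F := O) (mem_image_of_mem γ (by simp : (0:ℝ) ∈ Icc 0 1))
    (by rintro _ ⟨t, ht, rfl⟩; exact hO t ht)
  rw [connectedComponentIn_eq h0]
  exact h2 (mem_image_of_mem γ (by simp))

theorem path_cont (hp : 2 ≤ p) (f g : VW p α Ω) {c : ℝ → ℝ} (hc : ContinuousOn c (Icc 0 1)) :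
    @ContinuousOn ℝ (Pt n → ℝ) _ (topW p α Ω)
      (fun t => ((c t • (f + t • (g - f)) : VW p α Ω) : Pt n → ℝ)) (Icc 0 1) := by
  unfold topW
  rw [continuousOn_to_generateFrom_iff]
  rintro t0 ht0 _ ⟨w, r, rfl⟩ hlt
  obtain ⟨a, ha⟩ : ∃ a : ℝ → ℝ, a = fun t => c t * (1 - t) := ⟨_, rfl⟩
  obtain ⟨b, hb⟩ : ∃ b : ℝ → ℝ, b = fun t => c t * t := ⟨_, rfl⟩
  have hat : Tendsto a (𝓝[Icc 0 1] t0) (𝓝 (a t0)) := by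
    have : ContinuousOn a (Icc 0 1) := by
      rw [ha]; exact hc.mul (by fun_prop)
    exact this t0 ht0
  have hbt : Tendsto b (𝓝[Icc 0 1] t0) (𝓝 (b t0)) := by
    have : ContinuousOn b (Icc 0 1) := by
      rw [hb]; exact hc.mul (by fun_prop)
    exact this t0 ht0
  have el : ∀ t, lpP p Ω (((c t • (f + t • (g - f)) : VW p α Ω) : Pt n → ℝ) - w)
      = ∫ x in Ω, |a t * (f : Pt n → ℝ) x + b t * (g : Pt n → ℝ) x - w x| ^ p := by
    intro t
    unfold lpP
    congr 1; funext x
    simp only [ha, hb, Pi.sub_apply, Pi.add_apply, Pi.smul_apply, Submodule.coe_smul,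
      Submodule.coe_add, Submodule.coe_sub, smul_eq_mul]
    congr 2; ring
  have eg : ∀ t, gagP p α Ω (((c t • (f + t • (g - f)) : VW p α Ω) : Pt n → ℝ) - w)
      = ∫ z, |a t * Dif (f : Pt n → ℝ) z + b t * Dif (g : Pt n → ℝ) z - Dif w z| ^ p
        ∂(nuQ p α Ω) := by
    intro t
    rw [gagP_eq]
    congr 1; funext x
    simp only [ha, hb, Dif, Pi.sub_apply, Pi.add_apply, Pi.smul_apply, Submodule.coe_smul,
      Submodule.coe_add, Submodule.coe_sub, smul_eq_mul]
    congr 2; ring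
  have hlt' : normW p α Ω (((c t0 • (f + t0 • (g - f)) : VW p α Ω) : Pt n → ℝ) - w) < r := hlt
  unfold normW at hlt'
  rw [el, eg] at hlt'
  set X := ∫ x in Ω, |a t0 * (f : Pt n → ℝ) x + b t0 * (g : Pt n → ℝ) x - w x| ^ p with hX
  set Z := ∫ z, |a t0 * Dif (f : Pt n → ℝ) z + b t0 * Dif (g : Pt n → ℝ) z - Dif w z| ^ p
        ∂(nuQ p α Ω) with hZ
  obtain ⟨δ, hδ, hδr⟩ : ∃ δ > 0, (X + δ + (Z + δ)) ^ (1 / p) < r := by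
    have h1 : Tendsto (fun δ : ℝ => (X + δ + (Z + δ)) ^ (1 / p)) (𝓝[>] 0)
        (𝓝 ((X + Z) ^ (1 / p))) := by
      have : Continuous fun δ : ℝ => (X + δ + (Z + δ)) ^ (1 / p) :=
        Continuous.rpow_const (by fun_prop) fun _ => Or.inr (by positivity)
      have h := (this.tendsto 0).mono_left (nhdsWithin_le_nhds (s := Ioi 0))
      simpa using h
    have h2 := h1.eventually_lt_const hlt'
    have h3 : ∀ᶠ δ : ℝ in 𝓝[>] 0, δ ∈ Ioi (0:ℝ) := self_mem_nhdsWithin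
    obtain ⟨δ, h4, h5⟩ := (h2.and h3).exists
    exact ⟨δ, h5, h4⟩
  have u1 := usc_int hp f.2.2.1 g.2.2.1 w hat hbt hδ
  have u2 := usc_int hp f.2.2.2 g.2.2.2 (Dif w) hat hbt hδ
  filter_upwards [u1, u2] with t h1 h2
  show normW p α Ω (((c t • (f + t • (g - f)) : VW p α Ω) : Pt n → ℝ) - w) < r
  unfold normW
  refine lt_of_le_of_lt ?_ hδr
  refine Real.rpow_le_rpow (add_nonneg (lpP_nonneg _) (gagP_nonneg _)) ?_ (by positivity)
  rw [el, eg]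
  exact add_le_add h1 h2

variable [Fact (1 ≤ ENNReal.ofReal p)]

theorem J_eq (hp : 2 ≤ p) (hΩo : IsOpen Ω) (ε s : ℝ) (u : VW p α Ω) :
    Jfun p α ε s Ω u = energy p α Ω u - s * PP p ε Ω (Phi1 p α Ω u) := by
  unfold Jfun
  rw [PP_eq hp hΩo]; ring

theorem norml (hp : 2 ≤ p) (hΩo : IsOpen Ω) {ε s r : ℝ} (u : VW p α Ω)
    (h0 : 0 < NN p ε Ω (Phi1 p α Ω u))
    (h1 : energy p α Ω u - s * PP p ε Ω (Phi1 p α Ω u) < r * NN p ε Ω (Phi1 p α Ω u)) :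
    (((NN p ε Ω (Phi1 p α Ω u)) ^ (-(1 / p)) • u : VW p α Ω) : Pt n → ℝ) ∈
      {u : Pt n → ℝ | sphereS p α ε Ω u ∧ Jfun p α ε s Ω u < r} := by
  set K := NN p ε Ω (Phi1 p α Ω u) with hK
  have hc : 0 < K ^ (-(1 / p)) := Real.rpow_pos_of_pos h0 _
  have hcp : (K ^ (-(1 / p))) ^ p = K⁻¹ := by
    rw [← Real.rpow_mul h0.le, show -(1 / p) * p = -1 by field_simp, Real.rpow_neg_one]
  refine ⟨⟨(memW_iff hp).2 (SetLike.coe_mem _), ?_⟩, ?_⟩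
  · rw [← NN_eq hp hΩo, map_smul, NN_hom _ _ hc, hcp, ← hK, inv_mul_cancel₀ h0.ne']
  · rw [J_eq hp hΩo, energy_hom, map_smul, PP_hom _ _ hc, abs_of_pos hc, hcp]
    have : K⁻¹ * (energy p α Ω u - s * PP p ε Ω (Phi1 p α Ω u)) < K⁻¹ * (r * K) := by gcongr
    calc _ = K⁻¹ * (energy p α Ω u - s * PP p ε Ω (Phi1 p α Ω u)) := by ring
      _ < _ := this
      _ = r := by field_simp

theorem exists_min (hp : 2 ≤ p) (hα : α ∈ Ioo (0:ℝ) 1) {ε : ℝ} (hε : 0 < ε) (hΩo : IsOpen Ω)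
    (hΩne : Ω.Nonempty) (hΩb : Bornology.IsBounded Ω) (s r : ℝ) (hs : 0 ≤ s) (u1 : Pt n → ℝ)
    (hu1 : u1 ∈ {u : Pt n → ℝ | sphereS p α ε Ω u ∧ Jfun p α ε s Ω u < r}) :
    ∃ u : VW p α Ω, (u : Pt n → ℝ) ∈ @connectedComponentIn (Pt n → ℝ) (topW p α Ω)
          {u : Pt n → ℝ | sphereS p α ε Ω u ∧ Jfun p α ε s Ω u < r} u1 ∧
      ∃ d : ℝ, energy p α Ω u - s * PP p ε Ω (Phi1 p α Ω u) = d ∧ NN p ε Ω (Phi1 p α Ω u) = 1 ∧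
      ∀ v : VW p α Ω, ∀ᶠ t in 𝓝 (0:ℝ), d * NN p ε Ω (Phi1 p α Ω (u + t • v)) ≤
        energy p α Ω (u + t • v : VW p α Ω) - s * PP p ε Ω (Phi1 p α Ω (u + t • v)) := by
  obtain ⟨O, hO⟩ : ∃ O : Set (Pt n → ℝ),
    O = {u : Pt n → ℝ | sphereS p α ε Ω u ∧ Jfun p α ε s Ω u < r} := ⟨_, rfl⟩
  have hnorm := fun u : VW p α Ω => norml (ε := ε) (s := s) (r := r) hp hΩo u
  rw [← hO] at hu1 ⊢
  simp only [← hO] at hnorm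
  set CC : Set (Pt n → ℝ) := @connectedComponentIn (Pt n → ℝ) (topW p α Ω) O u1 with hCC
  set C : Set (VW p α Ω) := {u | 0 < NN p ε Ω (Phi1 p α Ω u) ∧
    energy p α Ω u - s * PP p ε Ω (Phi1 p α Ω u) < r * NN p ε Ω (Phi1 p α Ω u) ∧
    (((NN p ε Ω (Phi1 p α Ω u)) ^ (-(1 / p)) • u : VW p α Ω) : Pt n → ℝ) ∈ CC} with hC
  have hone : ∀ u : VW p α Ω, NN p ε Ω (Phi1 p α Ω u) = 1 →
      (((NN p ε Ω (Phi1 p α Ω u)) ^ (-(1 / p)) • u : VW p α Ω) : Pt n → ℝ) = u := by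
    intro u hu
    rw [hu, Real.one_rpow, one_smul]
  have hne : C.Nonempty := by
    have hu1' := hu1
    rw [hO] at hu1'
    obtain ⟨⟨hm, hS⟩, hJ⟩ := hu1'
    have hS' : NN p ε Ω (Phi1 p α Ω ⟨u1, (memW_iff hp).1 hm⟩) = 1 := by
      rw [NN_eq hp hΩo]; exact hS
    refine ⟨⟨u1, (memW_iff hp).1 hm⟩, ?_, ?_, ?_⟩
    · rw [hS']; exact one_pos
    · rw [hS', ← J_eq hp hΩo, mul_one]; exact hJ
    · rw [hone _ hS']
      exact @mem_connectedComponentIn (Pt n → ℝ) (topW p α Ω) u1 O hu1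
  have hseg : ∀ u ∈ C, ∀ v : VW p α Ω, (∀ t ∈ Icc (0:ℝ) 1,
      0 < NN p ε Ω (Phi1 p α Ω (u + t • (v - u))) ∧
      energy p α Ω (u + t • (v - u) : VW p α Ω) - s * PP p ε Ω (Phi1 p α Ω (u + t • (v - u)))
        < r * NN p ε Ω (Phi1 p α Ω (u + t • (v - u)))) → v ∈ C := by
    intro u hu v H
    have hv : u + (1:ℝ) • (v - u) = v := by rw [one_smul]; abel
    have hu0 : u + (0:ℝ) • (v - u) = u := by rw [zero_smul, add_zero]
    have H1 := H 1 (by simp)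
    rw [hv] at H1
    refine ⟨H1.1, H1.2, ?_⟩
    have hcont : ContinuousOn (fun t : ℝ =>
        (NN p ε Ω (Phi1 p α Ω (u + t • (v - u)))) ^ (-(1 / p))) (Icc 0 1) := by
      refine ContinuousOn.rpow_const ?_ fun t ht => Or.inl (H t ht).1.ne'
      refine ((NN_cont hp ε).comp ?_).continuousOn
      simp only [map_add, map_smul]
      fun_prop
    have := @conn_abs (Pt n → ℝ) (topW p α Ω) O u1
      (fun t => (((NN p ε Ω (Phi1 p α Ω (u + t • (v - u)))) ^ (-(1 / p)) •
        (u + t • (v - u)) : VW p α Ω) : Pt n → ℝ)) (path_cont hp u v hcont)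
      (fun t ht => hnorm _ (H t ht).1 (H t ht).2) (by
        simp only [hu0]; exact hu.2.2)
    simp only [hv] at this
    exact this
  obtain ⟨u, huC, hu1, d, hd, hmin⟩ := abs_min p s r (by linarith) hs
    (fun u : VW p α Ω => energy p α Ω u) (Phi1 p α Ω) (NN p ε Ω) (PP p ε Ω)
    (fun u => energy_nonneg hp hα.2 _) (fun c u => energy_hom c u)
    (fun u v => energy_clarkson hp hα.2 u v)
    (fun u v t ht => energy_convex hp hα.2 u v t ht)
    (fun f u h => energy_hcont hp hα.2 f u h)
    (fun f u h => ((energy_tendsto_zero_iff hp hα.2 f u).1 h).1)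
    (fun f h => energy_compl hp hα.2 hΩo hΩne f h)
    (fun f M h => energy_comp hp hα.1 hα.2 hΩo hΩne hΩb f M h)
    (NN_cont hp ε) (PP_cont hp ε) (fun c hc y => NN_hom ε c hc y) (fun c hc y => PP_hom ε c hc y)
    (fun y => PP_le hp ε hε y) C (fun u hu => ⟨hu.1, hu.2.1⟩) hne hseg
  refine ⟨u, ?_, d, hd, hu1, hmin⟩
  have := huC.2.2
  rwa [hone u hu1] at this

theorem crit_of_min (hp : 2 ≤ p) {ε : ℝ} (hΩo : IsOpen Ω) (s d : ℝ)
    (u v : VW p α Ω) (hd : energy p α Ω u - s * PP p ε Ω (Phi1 p α Ω u) = d)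
    (h1 : NN p ε Ω (Phi1 p α Ω u) = 1)
    (hmin : ∀ᶠ t in 𝓝 (0:ℝ), d * NN p ε Ω (Phi1 p α Ω (u + t • v)) ≤
        energy p α Ω (u + t • v : VW p α Ω) - s * PP p ε Ω (Phi1 p α Ω (u + t • v))) :
    Lam n p * (1 - α) * Hform p α Ω u v
        + (∫ x in Ω, |(u : Pt n → ℝ) x| ^ (p - 2) * (u : Pt n → ℝ) x * (v : Pt n → ℝ) x)
        - (s / ε) * (∫ x in Oeps Ω ε, pPart u x ^ (p - 1) * (v : Pt n → ℝ) x)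
      = (d / ε) * ∫ x in Oeps Ω ε,
        |(u : Pt n → ℝ) x| ^ (p - 2) * (u : Pt n → ℝ) x * (v : Pt n → ℝ) x := by
  have hmo : volume.restrict (Oeps Ω ε) ≤ volume.restrict Ω :=
    Measure.restrict_mono (Oeps_sub Ω ε) le_rfl
  have d1 := deriv_int_abs hp u.2.2.2 v.2.2.2
  have d2 := deriv_int_abs hp u.2.2.1 v.2.2.1
  have d3 := deriv_int_pos hp (u.2.2.1.mono_measure hmo) (v.2.2.1.mono_measure hmo)
  have d4 := deriv_int_abs hp (u.2.2.1.mono_measure hmo) (v.2.2.1.mono_measure hmo)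
  have e1 : ∀ t : ℝ, gagP p α Ω (u + t • v : VW p α Ω)
      = ∫ z, |Dif (u : Pt n → ℝ) z + t * Dif (v : Pt n → ℝ) z| ^ p ∂(nuQ p α Ω) := by
    intro t
    rw [gagP_eq]
    congr 1; funext z
    simp only [Dif, Pi.add_apply, Pi.smul_apply, Submodule.coe_smul,
      Submodule.coe_add, smul_eq_mul]
    congr 2; ring
  have hD := (((d1.const_mul (Lam n p * (1 - α))).add d2).sub
    (d3.const_mul (s * (1 / ε)))).sub (d4.const_mul (d * (1 / ε)))
  set G : ℝ → ℝ := fun t => energy p α Ω (u + t • v : VW p α Ω)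
    - s * PP p ε Ω (Phi1 p α Ω (u + t • v)) - d * NN p ε Ω (Phi1 p α Ω (u + t • v)) with hG
  have hDG : HasDerivAt G _ 0 := hD.congr_of_eventuallyEq (Eventually.of_forall fun t => by
    simp only [hG, energy, e1, PP_eq hp hΩo, NN_eq hp hΩo, ← mul_assoc]
    rfl)
  have hloc : IsLocalMin G 0 := by
    have hG0 : G 0 = 0 := by
      simp only [hG, zero_smul, add_zero, h1, hd]; ring
    filter_upwards [hmin] with t ht
    rw [hG0]
    simp only [hG]; linarith
  have hz := hloc.hasDerivAt_eq_zero hDG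
  rw [Hform_eq]
  have hp0 : p ≠ 0 := by linarith
  apply mul_left_cancel₀ hp0
  have e3 : (∫ x in Oeps Ω ε, pPart u x ^ (p - 1) * (v : Pt n → ℝ) x)
    = ∫ x in Oeps Ω ε, (max ((u : Pt n → ℝ) x) 0) ^ (p - 1) * (v : Pt n → ℝ) x := rfl
  rw [e3]
  linear_combination hz

end final

/-- every connected component of `O = {u ∈ S : J_s(u) < r}` (topology of
`‖·‖_{α,p}`) contains a critical point of `J_s` restricted to `S`. -/
theorem stmt_7 (n : ℕ) (p α ε : ℝ) (Ω : Set (Pt n))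
    (hn : 1 ≤ n) (hp : 2 ≤ p)
    (hα : α ∈ Set.Ioo (0 : ℝ) 1) (hε : ε ∈ Set.Ioo (0 : ℝ) 1)
    (hnpα : p * α < (n : ℝ))
    (hΩo : IsOpen Ω) (hΩconn : IsConnected Ω) (hΩbdd : Bornology.IsBounded Ω)
    (s r : ℝ) (hs : 0 ≤ s) :
    ∀ u1 ∈ {u : Pt n → ℝ | sphereS p α ε Ω u ∧ Jfun p α ε s Ω u < r},
      ∃ u0 ∈ @connectedComponentIn (Pt n → ℝ) (topW p α Ω)
          {u : Pt n → ℝ | sphereS p α ε Ω u ∧ Jfun p α ε s Ω u < r} u1,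
        ∃ μ : ℝ, ∀ v, memW p α Ω v →
          Lam n p * (1 - α) * Hform p α Ω u0 v
              + (∫ x in Ω, |u0 x| ^ (p - 2) * u0 x * v x)
              - (s / ε) * (∫ x in Oeps Ω ε, pPart u0 x ^ (p - 1) * v x)
            = (μ / ε) * ∫ x in Oeps Ω ε, |u0 x| ^ (p - 2) * u0 x * v x := by
  intro u1 hu1
  have : Fact (1 ≤ ENNReal.ofReal p) := ⟨by
    rw [← ENNReal.ofReal_one]; exact ENNReal.ofReal_le_ofReal (by linarith)⟩
  obtain ⟨u, hu, d, hd, h1, hmin⟩ := exists_min hp hα hε.1 hΩo hΩconn.nonempty hΩbdd s r hs u1 hu1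
  refine ⟨u, hu, d, fun v hv => ?_⟩
  exact crit_of_min hp hΩo s d u ⟨v, (memW_iff hp).1 hv⟩ hd h1 (hmin _)
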